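/- (Koivusalo–Levesley–Ward–Zhang) Let m ≥ 1 and τ = (τ1, …, τm) with τ1 = τ2 = ⋯ = τm > 1/m. Then for any ball B ⊆ [0,1]^m of positive radius, dim_H(B ∩ B_m(Ψ_τ)) = dim_H A_m(Ψ_τ) = (m + 1)/(1 + τ1). -/

import Mathlib

open MeasureTheory Set

noncomputable section

/-- The set of Ψ-approximable vectors in `[0,1]^m`: points `x` such that for infinitely many
positive integers `q` there exists `p ∈ ℤ^m` with `|q * x i - p i| < Ψ q i` for all `i`. -/
def approxSet (m : ℕ) (Ψ : ℕ → Fin m → ℝ) : Set (Fin m → ℝ) :=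
  {x | (∀ i, x i ∈ Set.Icc (0:ℝ) 1) ∧
    {q : ℕ | 0 < q ∧ ∃ p : Fin m → ℤ,
      ∀ i, |(q : ℝ) * x i - (p i : ℝ)| < Ψ q i}.Infinite}

/-- The set of weighted Ψ-badly approximable vectors:
`B_m(Ψ) = A_m(Ψ) \ ⋂_{0<c<1} A_m(cΨ)`. -/
def badSet (m : ℕ) (Ψ : ℕ → Fin m → ℝ) : Set (Fin m → ℝ) :=
  approxSet m Ψ \ ⋂ c ∈ Set.Ioo (0:ℝ) 1, approxSet m (fun q i => c * Ψ q i)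

/-- The power-law approximation function `Ψ_τ`, with `ψ_i(q) = q^{-τ_i}`. -/
def psiTau (m : ℕ) (τ : Fin m → ℝ) : ℕ → Fin m → ℝ :=
  fun q i => (q : ℝ) ^ (-(τ i))

/-- The integer points of the closed sup-norm ball of radius `r` around `a`. -/
def intBox {m : ℕ} (a : Fin m → ℝ) (r : ℝ) : Finset (Fin m → ℤ) :=
  Fintype.piFinset fun i => Finset.Icc ⌈a i - r⌉ ⌊a i + r⌋

lemma mem_intBox {m : ℕ} {a : Fin m → ℝ} {r : ℝ} {p : Fin m → ℤ} :
    p ∈ intBox a r ↔ ∀ i, |(p i : ℝ) - a i| ≤ r := by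
  simp only [intBox, Fintype.mem_piFinset, Finset.mem_Icc, Int.ceil_le, Int.le_floor, abs_le]
  refine forall_congr' fun i => ⟨fun h => ⟨by linarith, by linarith⟩,
    fun h => ⟨by linarith, by linarith⟩⟩

lemma card_intBox {m : ℕ} (a : Fin m → ℝ) (r : ℝ) :
    (intBox a r).card = ∏ i, (⌊a i + r⌋ + 1 - ⌈a i - r⌉).toNat := by
  simp [intBox, Fintype.card_piFinset]

lemma card_intBox_le {m : ℕ} (a : Fin m → ℝ) {r : ℝ} (hr : 0 ≤ r) :
    ((intBox a r).card : ℝ) ≤ (2 * r + 1) ^ m := by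
  rw [card_intBox, Nat.cast_prod]
  calc _ ≤ ∏ _i : Fin m, (2 * r + 1) := by
        refine Finset.prod_le_prod (fun i _ => by positivity) fun i _ => ?_
        have h1 := Int.floor_le (a i + r)
        have h2 := Int.le_ceil (a i - r)
        rcases le_total 0 (⌊a i + r⌋ + 1 - ⌈a i - r⌉) with h | h
        · have : ((⌊a i + r⌋ + 1 - ⌈a i - r⌉).toNat : ℝ) = ((⌊a i + r⌋ + 1 - ⌈a i - r⌉ : ℤ) : ℝ) := by
            exact_mod_cast congrArg (Int.cast : ℤ → ℝ) (Int.toNat_of_nonneg h)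
          rw [this]; push_cast; linarith
        · rw [Int.toNat_of_nonpos h]; push_cast; linarith
    _ = _ := by simp

lemma le_card_intBox {m : ℕ} (a : Fin m → ℝ) {r : ℝ} (hr : 1 ≤ 2 * r) :
    (2 * r - 1) ^ m ≤ ((intBox a r).card : ℝ) := by
  rw [card_intBox, Nat.cast_prod]
  calc _ = ∏ _i : Fin m, (2 * r - 1) := by simp
    _ ≤ _ := by
        refine Finset.prod_le_prod (fun i _ => by linarith) fun i _ => ?_
        have h1 := Int.lt_floor_add_one (a i + r)
        have h2 := Int.ceil_lt_add_one (a i - r)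
        have h3 : ((⌊a i + r⌋ + 1 - ⌈a i - r⌉ : ℤ) : ℝ) ≤ ((⌊a i + r⌋ + 1 - ⌈a i - r⌉).toNat : ℝ) := by
          exact_mod_cast Int.cast_le.2 (Int.self_le_toNat _)
        push_cast at h3; linarith

/-- A family of points separated by `δ` in the sup norm inside a ball of radius `X` has at most
`(2 * X / δ + 2) ^ m` members. -/
lemma card_le_of_separated {m : ℕ} {ι : Type*} (S : Finset ι) (f : ι → Fin m → ℝ) {δ X : ℝ}
    (hδ : 0 < δ) (hX : 0 ≤ X) (z : Fin m → ℝ) (hz : ∀ a ∈ S, ∀ i, |f a i - z i| ≤ X)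
    (hsep : ∀ a ∈ S, ∀ b ∈ S, a ≠ b → ∃ i, δ ≤ |f a i - f b i|) :
    (S.card : ℝ) ≤ (2 * X / δ + 2) ^ m := by
  have key : S.card ≤ (intBox (fun _ : Fin m => (-1 / 2 : ℝ)) (X / δ + 1 / 2)).card := by
    refine Finset.card_le_card_of_injOn (fun a i => ⌊(f a i - z i) / δ⌋) ?_ ?_
    · intro a ha
      refine mem_intBox.2 fun i => ?_
      have h1 := Int.floor_le ((f a i - z i) / δ)
      have h2 := Int.lt_floor_add_one ((f a i - z i) / δ)
      have h3 := abs_le.1 (hz a ha i)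
      have h4 : (f a i - z i) / δ ≤ X / δ := by gcongr; exact h3.2
      have h5 : -(X / δ) ≤ (f a i - z i) / δ := by
        rw [← neg_div]; gcongr; exact h3.1
      rw [abs_le]; constructor <;> linarith
    · intro a ha b hb hab
      by_contra hne
      obtain ⟨i, hi⟩ := hsep a ha b hb hne
      have hab' : ⌊(f a i - z i) / δ⌋ = ⌊(f b i - z i) / δ⌋ := congrFun hab i
      have := Int.abs_sub_lt_one_of_floor_eq_floor hab'
      rw [← sub_div, abs_div, abs_of_pos hδ, div_lt_one hδ] at this
      rw [show f a i - z i - (f b i - z i) = f a i - f b i by ring] at this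
      linarith
  calc (S.card : ℝ) ≤ _ := by exact_mod_cast key
    _ ≤ _ := card_intBox_le _ (by positivity)
    _ = _ := by congr 1; ring

/-- For a prime `q` and a multiplier `0 < j < q`, few residues `p` mod `q` have `j * p` within
`r` of `q * ℤ^m`. -/
lemma card_le_of_near_multiple {m : ℕ} {q : ℕ} (hq : q.Prime) {j : ℕ} (hj : 0 < j)
    (hjq : j < q) {r : ℝ} (hr : 0 ≤ r) (S : Finset (Fin m → ℤ))
    (hinj : ∀ p ∈ S, ∀ p' ∈ S, (∀ i, (q : ℤ) ∣ p i - p' i) → p = p')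
    (h0 : ∀ p ∈ S, ¬ ∀ i, (q : ℤ) ∣ p i)
    (hS : ∀ p ∈ S, ∃ p' : Fin m → ℤ, ∀ i, |(j : ℝ) * p i - q * p' i| ≤ r) :
    (S.card : ℝ) ≤ 3 ^ m * r ^ m := by
  classical
  have hcop : IsCoprime (q : ℤ) (j : ℤ) :=
    Nat.isCoprime_iff_coprime.2 ((Nat.coprime_of_lt_prime hj.ne' hjq hq))
  choose! g hg using hS
  set w : (Fin m → ℤ) → Fin m → ℤ := fun p i => j * p i - q * g p i with hw
  have hdvd : ∀ a : ℤ, (q : ℤ) ∣ j * a → (q : ℤ) ∣ a := fun a h => hcop.dvd_of_dvd_mul_left h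
  have hwr : ∀ p ∈ S, ∀ i, |((w p i : ℤ) : ℝ)| ≤ r := by
    intro p hp i; have := hg p hp i; simpa [hw] using this
  have hw0 : ∀ p ∈ S, ∃ i, w p i ≠ 0 := by
    intro p hp
    by_contra! h
    refine h0 p hp fun i => hdvd _ ?_
    have := h i
    exact ⟨g p i, by simp only [hw] at this; linarith⟩
  rcases lt_or_ge r 1 with h1 | h1
  · have : S = ∅ := by
      refine Finset.eq_empty_of_forall_notMem fun p hp => ?_
      obtain ⟨i, hi⟩ := hw0 p hp
      have h2 := hwr p hp i
      have h3 : (1 : ℝ) ≤ |((w p i : ℤ) : ℝ)| := by exact_mod_cast Int.one_le_abs hi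
      linarith
    rw [this]; simp; positivity
  · have key : S.card ≤ (intBox (fun _ : Fin m => (0 : ℝ)) r).card := by
      refine Finset.card_le_card_of_injOn w ?_ ?_
      · intro p hp
        refine mem_intBox.2 fun i => ?_
        simpa using hwr p hp i
      · intro p hp p' hp' hpp
        refine hinj p hp p' hp' fun i => hdvd _ ?_
        have := congrFun hpp i
        simp only [hw] at this
        exact ⟨g p i - g p' i, by linarith⟩
    calc (S.card : ℝ) ≤ _ := by exact_mod_cast key
      _ ≤ (2 * r + 1) ^ m := card_intBox_le _ hr
      _ ≤ (3 * r) ^ m := by gcongr; linarith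
      _ = _ := mul_pow _ _ _

/-- The fraction `p / q` is in lowest terms with prime denominator, and the lattice
`ℤ^m + ℤ (p / q)` has no short nonzero vectors. -/
def IsGood {m : ℕ} (η : ℝ) (q : ℕ) (p : Fin m → ℤ) : Prop :=
  q.Prime ∧ ∀ j : ℕ, 0 < j → j < q → ∀ p' : Fin m → ℤ,
    ∃ i, (q : ℝ) ^ (1 - 1 / (m : ℝ) - η) < |(j : ℝ) * p i - q * p' i|

open Filter Topology in
lemma exists_many_good {m : ℕ} (hm : m ≠ 0) {c η : ℝ} (hη : 0 < η) {ρ : ℝ} (hρ0 : 0 < ρ)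
    (hρ1 : ρ < 1) (R : ℕ) (hR : 1 ≤ R) {E : ℝ} (hE : E = 1 / (8 * 2 ^ m))
    (htail : ∀ n, 3 ^ m * ∑ j ∈ Finset.Ico R n, (j : ℝ) ^ (-(m * c)) ≤ E * ρ ^ m)
    {κ : Type*} (D : Finset κ) (z : κ → Fin m → ℝ) (rad : κ → ℝ)
    (hrad : ∀ d ∈ D, 0 < rad d) (hD : 3 ^ m * ∑ d ∈ D, rad d ^ m ≤ E * ρ ^ m)
    (y : Fin m → ℝ) :
    ∃ Q₀ : ℕ, ∀ q : ℕ, Q₀ ≤ q → q.Prime → ∃ S : Finset (Fin m → ℤ),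
      (∀ p ∈ S, (∀ i, |(p i : ℝ) - q * y i| ≤ q * ρ / 2) ∧ IsGood η q p ∧
        (∀ j : ℕ, R ≤ j → j < q → ∀ p' : Fin m → ℤ,
          ∃ i, (q : ℝ) * (j : ℝ) ^ (-c) < |(j : ℝ) * p i - q * p' i|) ∧
        ∀ d ∈ D, ∃ i, rad d < |(p i : ℝ) / q - z d i|) ∧
      E * (ρ ^ m * (q : ℝ) ^ m) ≤ S.card := by
  classical
  have hE0 : 0 < E := by rw [hE]; positivity
  have hm1 : 1 ≤ m := Nat.one_le_iff_ne_zero.2 hm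
  have hmR : (m : ℝ) ≠ 0 := by exact_mod_cast hm
  have hm0 : (0 : ℝ) < m := by positivity
  have ev1 : ∀ᶠ q : ℕ in atTop, 2 / ρ ≤ (q : ℝ) := tendsto_natCast_atTop_atTop.eventually_ge_atTop _
  have ev2 : ∀ᶠ q : ℕ in atTop, 1 / (E * ρ ^ m) ≤ (q : ℝ) :=
    tendsto_natCast_atTop_atTop.eventually_ge_atTop _
  have ev3 : ∀ᶠ q : ℕ in atTop, 3 ^ m * (q : ℝ) ^ (-(m * η)) ≤ E * ρ ^ m := by
    have h : Tendsto (fun q : ℕ => 3 ^ m * (q : ℝ) ^ (-(m * η))) atTop (𝓝 (3 ^ m * 0)) :=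
      ((tendsto_rpow_neg_atTop (by positivity)).comp tendsto_natCast_atTop_atTop).const_mul _
    rw [mul_zero] at h
    exact (h.eventually_lt_const (by positivity)).mono fun _ h => h.le
  have ev4 : ∀ᶠ q : ℕ in atTop, ∀ d ∈ D, 1 / rad d ≤ (q : ℝ) :=
    (Finset.eventually_all D).2 fun d _ => tendsto_natCast_atTop_atTop.eventually_ge_atTop _
  obtain ⟨Q₀, hQ₀⟩ := eventually_atTop.1 (ev1.and (ev2.and (ev3.and ev4)))
  refine ⟨Q₀, fun q hq hqp => ?_⟩
  obtain ⟨h1, h2, h3, h4⟩ := hQ₀ q hq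
  have hq0 : (0 : ℝ) < q := by exact_mod_cast hqp.pos
  have hq1 : (1 : ℝ) ≤ q := by exact_mod_cast hqp.one_lt.le
  set T := intBox (fun i => q * y i) (q * ρ / 2) with hT
  have hTinj : ∀ p ∈ T, ∀ p' ∈ T, (∀ i, (q : ℤ) ∣ p i - p' i) → p = p' := by
    intro p hp p' hp' h
    ext i
    have a1 := abs_le.1 (mem_intBox.1 hp i)
    have a2 := abs_le.1 (mem_intBox.1 hp' i)
    have a3 : |((p i - p' i : ℤ) : ℝ)| < q := by
      push_cast
      have : (q : ℝ) * ρ < q := by nlinarith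
      rw [abs_lt]; constructor <;> linarith [a1.1, a1.2, a2.1, a2.2]
    have a4 : |p i - p' i| < (q : ℤ) := by exact_mod_cast a3
    have := Int.eq_zero_of_abs_lt_dvd (h i) a4
    linarith
  set L : ℝ := (q : ℝ) ^ (1 - 1 / (m : ℝ) - η) with hL
  have hL0 : 0 ≤ L := by positivity
  set bad0 := T.filter fun p => ∀ i, (q : ℤ) ∣ p i
  set near : ℕ → ℝ → Finset (Fin m → ℤ) := fun j r => T.filter fun p =>
    (¬ ∀ i, (q : ℤ) ∣ p i) ∧ ∃ p' : Fin m → ℤ, ∀ i, |(j : ℝ) * p i - q * p' i| ≤ r with hnear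
  have hcardnear : ∀ j, 0 < j → j < q → ∀ r, 0 ≤ r → ((near j r).card : ℝ) ≤ 3 ^ m * r ^ m := by
    intro j hj hjq r hr
    refine card_le_of_near_multiple hqp hj hjq hr _ ?_ ?_ ?_
    · intro p hp p' hp' h
      exact hTinj p (Finset.mem_filter.1 hp).1 p' (Finset.mem_filter.1 hp').1 h
    · intro p hp; exact (Finset.mem_filter.1 hp).2.1
    · intro p hp; exact (Finset.mem_filter.1 hp).2.2
  set badA := (Finset.Ico 1 q).biUnion fun j => near j L
  set badB := (Finset.Ico R q).biUnion fun j => near j (q * (j : ℝ) ^ (-c))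
  set badC := D.biUnion fun d => T.filter fun p => ∀ i, |(p i : ℝ) / q - z d i| ≤ rad d
  have hP : 0 < E * ρ ^ m := by positivity
  have c0 : (bad0.card : ℝ) ≤ E * ρ ^ m * (q : ℝ) ^ m := by
    have : bad0.card ≤ 1 := by
      rw [Finset.card_le_one]
      intro a ha b hb
      refine hTinj a (Finset.mem_filter.1 ha).1 b (Finset.mem_filter.1 hb).1 fun i => ?_
      exact dvd_sub ((Finset.mem_filter.1 ha).2 i) ((Finset.mem_filter.1 hb).2 i)
    have h5 : (bad0.card : ℝ) ≤ 1 := by exact_mod_cast this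
    have h6 : (q : ℝ) ≤ (q : ℝ) ^ m := le_self_pow₀ hq1 hm
    rw [div_le_iff₀ hP] at h2
    nlinarith
  have cA : (badA.card : ℝ) ≤ E * ρ ^ m * (q : ℝ) ^ m := by
    have hLm : L ^ m = (q : ℝ) ^ (-(m * η)) * (q : ℝ) ^ m / q := by
      rw [hL, ← Real.rpow_natCast, ← Real.rpow_mul hq0.le, ← Real.rpow_natCast (q : ℝ) m,
        ← Real.rpow_add hq0, ← Real.rpow_sub_one hq0.ne']
      congr 1; field_simp; ring
    calc (badA.card : ℝ) ≤ ∑ j ∈ Finset.Ico 1 q, ((near j L).card : ℝ) := by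
          exact_mod_cast Finset.card_biUnion_le
      _ ≤ ∑ _j ∈ Finset.Ico 1 q, 3 ^ m * L ^ m := Finset.sum_le_sum fun j hj => by
          rw [Finset.mem_Ico] at hj
          exact hcardnear j (by omega) hj.2 L hL0
      _ = ((q - 1 : ℕ) : ℝ) * (3 ^ m * L ^ m) := by simp
      _ ≤ q * (3 ^ m * L ^ m) := by
          gcongr; exact_mod_cast Nat.sub_le _ _
      _ = 3 ^ m * (q : ℝ) ^ (-(m * η)) * (q : ℝ) ^ m := by rw [hLm]; field_simp
      _ ≤ _ := by gcongr
  have cB : (badB.card : ℝ) ≤ E * ρ ^ m * (q : ℝ) ^ m := by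
    calc (badB.card : ℝ) ≤ ∑ j ∈ Finset.Ico R q, ((near j (q * (j : ℝ) ^ (-c))).card : ℝ) := by
          exact_mod_cast Finset.card_biUnion_le
      _ ≤ ∑ j ∈ Finset.Ico R q, (3 ^ m * (j : ℝ) ^ (-(m * c))) * (q : ℝ) ^ m := by
          refine Finset.sum_le_sum fun j hj => ?_
          rw [Finset.mem_Ico] at hj
          refine (hcardnear j (by omega) hj.2 _ (by positivity)).trans (le_of_eq ?_)
          rw [mul_pow, ← Real.rpow_natCast ((j : ℝ) ^ (-c)), ← Real.rpow_mul (Nat.cast_nonneg j),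
            show -c * (m : ℝ) = -(m * c) by ring]
          ring
      _ = (3 ^ m * ∑ j ∈ Finset.Ico R q, (j : ℝ) ^ (-(m * c))) * (q : ℝ) ^ m := by
          rw [← Finset.sum_mul, Finset.mul_sum]
      _ ≤ _ := mul_le_mul_of_nonneg_right (htail q) (by positivity)
  have cC : (badC.card : ℝ) ≤ E * ρ ^ m * (q : ℝ) ^ m := by
    calc (badC.card : ℝ) ≤ ∑ d ∈ D,
            ((T.filter fun p => ∀ i, |(p i : ℝ) / q - z d i| ≤ rad d).card : ℝ) := by
          rw [← Nat.cast_sum]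
          exact Nat.cast_le.2 Finset.card_biUnion_le
      _ ≤ ∑ d ∈ D, (3 ^ m * rad d ^ m) * (q : ℝ) ^ m := by
          refine Finset.sum_le_sum fun d hd => ?_
          have hsub : (T.filter fun p => ∀ i, |(p i : ℝ) / q - z d i| ≤ rad d) ⊆
              intBox (fun i => q * z d i) (q * rad d) := by
            intro p hp
            refine mem_intBox.2 fun i => ?_
            have := (Finset.mem_filter.1 hp).2 i
            calc |(p i : ℝ) - q * z d i| = q * |(p i : ℝ) / q - z d i| := by
                  rw [← abs_of_pos hq0, ← abs_mul, abs_of_pos hq0]; congr 1; field_simp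
              _ ≤ _ := by gcongr
          have hrd := hrad d hd
          have h5 := h4 d hd
          rw [div_le_iff₀ hrd] at h5
          calc _ ≤ ((intBox (fun i => q * z d i) (q * rad d)).card : ℝ) := by
                exact_mod_cast Finset.card_le_card hsub
            _ ≤ (2 * (q * rad d) + 1) ^ m := card_intBox_le _ (by positivity)
            _ ≤ (3 * rad d * q) ^ m := by gcongr; linarith
            _ = _ := by rw [mul_pow, mul_pow]
      _ = (3 ^ m * ∑ d ∈ D, rad d ^ m) * (q : ℝ) ^ m := by
          rw [← Finset.sum_mul, Finset.mul_sum]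
      _ ≤ _ := mul_le_mul_of_nonneg_right hD (by positivity)
  have cT : 8 * (E * ρ ^ m * (q : ℝ) ^ m) ≤ T.card := by
    rw [div_le_iff₀ hρ0] at h1
    calc 8 * (E * ρ ^ m * (q : ℝ) ^ m) = (q * ρ / 2) ^ m := by
          rw [hE, div_pow, mul_pow]; field_simp
      _ ≤ (2 * (q * ρ / 2) - 1) ^ m := by gcongr; linarith
      _ ≤ _ := le_card_intBox _ (by linarith)
  refine ⟨T \ (bad0 ∪ badA ∪ badB ∪ badC), ?_, ?_⟩
  · intro p hp
    simp only [Finset.mem_sdiff, Finset.mem_union, not_or] at hp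
    obtain ⟨hpT, ⟨⟨hp0, hpA⟩, hpB⟩, hpC⟩ := hp
    have hp0' : ¬ ∀ i, (q : ℤ) ∣ p i := fun h => hp0 (Finset.mem_filter.2 ⟨hpT, h⟩)
    refine ⟨mem_intBox.1 hpT, ⟨hqp, ?_⟩, ?_, ?_⟩
    · intro j hj hjq p'
      by_contra! h
      exact hpA (Finset.mem_biUnion.2 ⟨j, Finset.mem_Ico.2 ⟨hj, hjq⟩,
        Finset.mem_filter.2 ⟨hpT, hp0', p', h⟩⟩)
    · intro j hj hjq p'
      by_contra! h
      exact hpB (Finset.mem_biUnion.2 ⟨j, Finset.mem_Ico.2 ⟨hj, hjq⟩,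
        Finset.mem_filter.2 ⟨hpT, hp0', p', h⟩⟩)
    · intro d hd
      by_contra! h
      exact hpC (Finset.mem_biUnion.2 ⟨d, hd, Finset.mem_filter.2 ⟨hpT, h⟩⟩)
  · have k1 : (T.card : ℝ) ≤ ((T \ (bad0 ∪ badA ∪ badB ∪ badC)).card : ℝ) +
        ((bad0 ∪ badA ∪ badB ∪ badC).card : ℝ) := by
      exact_mod_cast Finset.card_le_card_sdiff_add_card
    have k2 : ((bad0 ∪ badA ∪ badB ∪ badC).card : ℝ) ≤
        bad0.card + badA.card + badB.card + badC.card := by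
      have e1 := Finset.card_union_le (bad0 ∪ badA ∪ badB) badC
      have e2 := Finset.card_union_le (bad0 ∪ badA) badB
      have e3 := Finset.card_union_le bad0 badA
      have : (bad0 ∪ badA ∪ badB ∪ badC).card ≤
        bad0.card + badA.card + badB.card + badC.card := by omega
      exact_mod_cast this
    have : 0 < E * ρ ^ m * (q : ℝ) ^ m := by positivity
    rw [← mul_assoc]
    linarith

/-- The fractions `p' / j` with `q ≤ j < R`, different from `p / q` but close to it. -/
def nearby {m : ℕ} (c : ℝ) (q : ℕ) (p : Fin m → ℤ) (R : ℕ) : Finset (Σ _ : ℕ, Fin m → ℤ) :=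
  open Classical in
  (Finset.Ico q R).sigma fun j =>
    (intBox (fun i => j * (p i / q)) (j * (2 * (q : ℝ) ^ (-1 - c)))).filter
      fun p' => ¬ ∀ i, (j : ℤ) * p i - q * p' i = 0

lemma sum_nearby_le {m : ℕ} (hm : m ≠ 0) {c η : ℝ} (hη : 0 < η) (hc : 1 < m * c) {q : ℕ}
    {p : Fin m → ℤ} (hp : IsGood η q p) (R : ℕ) :
    ∑ d ∈ nearby c q p R, (1 / 2 * (d.1 : ℝ) ^ (-1 - c)) ^ m ≤
      8 ^ m * (∑' a : ℕ, (a : ℝ) ^ (-(m * c))) *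
        ((q : ℝ) ^ (1 + m * η - m * c) * ((q : ℝ) ^ (-1 - c)) ^ m) := by
  classical
  have hm1 : (1 : ℝ) ≤ m := by exact_mod_cast Nat.one_le_iff_ne_zero.2 hm
  have hm0 : (m : ℝ) ≠ 0 := by positivity
  have hc0 : 0 < c := by
    by_contra! h
    nlinarith
  have hq0 : (0 : ℝ) < q := by exact_mod_cast hp.1.pos
  have hq1 : (1 : ℝ) ≤ q := by exact_mod_cast hp.1.one_lt.le
  set L : ℝ := (q : ℝ) ^ (1 - 1 / (m : ℝ) - η) with hL
  have hL0 : 0 < L := by positivity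
  have hLq : L ≤ q := by
    calc L ≤ (q : ℝ) ^ (1 : ℝ) := by
          refine Real.rpow_le_rpow_of_exponent_le hq1 ?_
          have : 0 ≤ 1 / (m : ℝ) := by positivity
          linarith
      _ = q := Real.rpow_one _
  set D := nearby c q p R with hD
  have hmem : ∀ d ∈ D, q ≤ d.1 ∧ d.1 < R ∧
      (∀ i, |(d.1 : ℝ) * p i - q * d.2 i| ≤ 2 * d.1 * (q : ℝ) ^ (-c)) ∧
      ¬ ∀ i, (d.1 : ℤ) * p i - q * d.2 i = 0 := by
    rintro ⟨j, p'⟩ hd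
    simp only [hD, nearby, Finset.mem_sigma, Finset.mem_Ico, Finset.mem_filter] at hd
    refine ⟨hd.1.1, hd.1.2, fun i => ?_, hd.2.2⟩
    have := mem_intBox.1 hd.2.1 i
    calc |(j : ℝ) * p i - q * p' i| = q * |(p' i : ℝ) - j * (p i / q)| := by
          rw [← abs_of_pos hq0, ← abs_mul, abs_of_pos hq0, abs_sub_comm]; congr 1; field_simp
      _ ≤ q * (j * (2 * (q : ℝ) ^ (-1 - c))) := by gcongr
      _ = 2 * j * (q : ℝ) ^ (-c) := by
          rw [show -1 - c = -c - 1 by ring, Real.rpow_sub_one hq0.ne']; field_simp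
  have hmaps : ∀ d ∈ D, d.1 / q ∈ Finset.Ico 1 (R + 1) := by
    intro d hd
    obtain ⟨h1, h2, -⟩ := hmem d hd
    rw [Finset.mem_Ico]
    exact ⟨(Nat.one_le_div_iff hp.1.pos).2 h1, (Nat.div_le_self _ _).trans_lt (by omega)⟩
  have hsepq : ∀ u v : Fin m → ℤ, u ≠ v → ∃ i, (q : ℝ) ≤ |(q : ℝ) * u i - q * v i| := by
    intro u v huv
    obtain ⟨i, hi⟩ := Function.ne_iff.1 huv
    refine ⟨i, ?_⟩
    have h1 : (1 : ℝ) ≤ |((u i - v i : ℤ) : ℝ)| := by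
      exact_mod_cast Int.one_le_abs (sub_ne_zero.2 hi)
    push_cast at h1
    rw [← mul_sub, abs_mul, abs_of_pos hq0]
    nlinarith
  have hfib : ∀ a ∈ Finset.Ico 1 (R + 1),
      ∑ d ∈ D with d.1 / q = a, (1 / 2 * (d.1 : ℝ) ^ (-1 - c)) ^ m ≤
        8 ^ m * ((q : ℝ) ^ (1 + m * η - m * c) * ((q : ℝ) ^ (-1 - c)) ^ m) *
          (a : ℝ) ^ (-(m * c)) := by
    intro a ha
    have ha1 : 1 ≤ a := (Finset.mem_Ico.1 ha).1
    have ha0 : (0 : ℝ) < a := by exact_mod_cast ha1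
    have ha1' : (1 : ℝ) ≤ a := by exact_mod_cast ha1
    set F := D.filter fun d => d.1 / q = a with hF
    set X : ℝ := 4 * a * q * (q : ℝ) ^ (-c) with hX
    have hblock : ∀ d ∈ F, a * q ≤ d.1 ∧ d.1 < a * q + q := by
      intro d hd
      have h1 := (Finset.mem_filter.1 hd).2
      have h2 := Nat.div_add_mod d.1 q
      have h3 := Nat.mod_lt d.1 hp.1.pos
      rw [h1] at h2
      rw [mul_comm a q]
      omega
    have hwX : ∀ d ∈ F, ∀ i, |(d.1 : ℝ) * p i - q * d.2 i| ≤ X := by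
      intro d hd i
      obtain ⟨-, -, h3, -⟩ := hmem d (Finset.mem_filter.1 hd).1
      have h4 : (d.1 : ℝ) ≤ 2 * a * q := by
        have : (d.1 : ℝ) ≤ a * q + q := by exact_mod_cast (hblock d hd).2.le
        nlinarith
      calc _ ≤ _ := h3 i
        _ ≤ 2 * (2 * a * q) * (q : ℝ) ^ (-c) := by gcongr
        _ = X := by rw [hX]; ring
    have hcard : (F.card : ℝ) ≤ (4 * X / L) ^ m := by
      rcases F.eq_empty_or_nonempty with he | ⟨d, hd⟩
      · rw [he]; simp; positivity
      have hLX : L ≤ X := by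
        obtain ⟨h1, h2, h3, h4⟩ := hmem d (Finset.mem_filter.1 hd).1
        obtain ⟨k, t, h5, ht⟩ : ∃ k t, d.1 = q * k + t ∧ t < q :=
          ⟨d.1 / q, d.1 % q, (Nat.div_add_mod _ _).symm, Nat.mod_lt _ hp.1.pos⟩
        have h6 : (d.1 : ℝ) = q * k + t := by exact_mod_cast h5
        rcases Nat.eq_zero_or_pos t with h0 | h0
        · subst h0
          have hne : (fun i => (k : ℤ) * p i) ≠ d.2 := by
            intro h
            refine h4 fun i => ?_
            rw [← congrFun h i, h5]
            push_cast; ring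
          obtain ⟨i, hi⟩ := hsepq _ _ hne
          refine hLq.trans (hi.trans ((le_of_eq ?_).trans (hwX d hd i)))
          rw [h6]; push_cast; congr 1; ring
        · obtain ⟨i, hi⟩ := hp.2 t h0 ht fun i => d.2 i - (k : ℤ) * p i
          refine hi.le.trans ((le_of_eq ?_).trans (hwX d hd i))
          rw [h6]; push_cast; congr 1; ring
      have hsep : ∀ d ∈ F, ∀ e ∈ F, d ≠ e → e.1 ≤ d.1 →
          ∃ i, L ≤ |((d.1 : ℝ) * p i - q * d.2 i) - ((e.1 : ℝ) * p i - q * e.2 i)| := by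
        rintro ⟨j, u⟩ hd ⟨j', v⟩ he hne hle
        obtain ⟨h1, h2⟩ := hblock _ hd
        obtain ⟨h3, h4⟩ := hblock _ he
        dsimp only at h1 h2 h3 h4 hle ⊢
        rcases hle.eq_or_lt with h | h
        · subst h
          have : u ≠ v := fun h => hne (by rw [h])
          obtain ⟨i, hi⟩ := hsepq u v this
          refine ⟨i, hLq.trans (hi.trans (le_of_eq ?_))⟩
          rw [abs_sub_comm]; congr 1; ring
        · obtain ⟨i, hi⟩ := hp.2 (j - j') (by omega) (by omega) (u - v)
          refine ⟨i, hi.le.trans (le_of_eq ?_)⟩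
          rw [Nat.cast_sub h.le]
          push_cast [Pi.sub_apply]; congr 1; ring
      have := card_le_of_separated F (fun d i => (d.1 : ℝ) * p i - q * d.2 i) hL0
        (hL0.le.trans hLX) 0 (by simpa using hwX) (by
          intro d hd e he hne
          rcases le_total e.1 d.1 with h | h
          · exact hsep d hd e he hne h
          · obtain ⟨i, hi⟩ := hsep e he d hd hne.symm h
            exact ⟨i, by rwa [abs_sub_comm]⟩)
      refine this.trans ?_
      have : 1 ≤ X / L := (one_le_div hL0).2 hLX
      gcongr
      have e1 : 2 * X / L = 2 * (X / L) := by ring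
      have e2 : 4 * X / L = 4 * (X / L) := by ring
      linarith
    have hterm : ∀ d ∈ F, (1 / 2 * (d.1 : ℝ) ^ (-1 - c)) ^ m ≤
        (1 / 2 * ((a : ℝ) * q) ^ (-1 - c)) ^ m := by
      intro d hd
      gcongr ?_ ^ m
      gcongr 1 / 2 * ?_
      refine Real.rpow_le_rpow_of_nonpos (by positivity) ?_ (by linarith)
      exact_mod_cast (hblock d hd).1
    calc _ ≤ ∑ _d ∈ F, (1 / 2 * ((a : ℝ) * q) ^ (-1 - c)) ^ m := Finset.sum_le_sum hterm
      _ = F.card * (1 / 2 * ((a : ℝ) * q) ^ (-1 - c)) ^ m := by simp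
      _ ≤ (4 * X / L) ^ m * (1 / 2 * ((a : ℝ) * q) ^ (-1 - c)) ^ m := by gcongr
      _ = _ := by
        have e1 : 4 * X / L * (1 / 2 * ((a : ℝ) * q) ^ (-1 - c)) =
            8 * ((q : ℝ) ^ (1 / (m : ℝ) + η - c) * (q : ℝ) ^ (-1 - c)) * (a : ℝ) ^ (-c) := by
          rw [Real.mul_rpow ha0.le hq0.le, hX,
            show (1 / (m : ℝ) + η - c) = (-c + 1) - (1 - 1 / (m : ℝ) - η) by ring,
            Real.rpow_sub hq0 (-c + 1), ← hL, Real.rpow_add_one hq0.ne',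
            show -1 - c = -c - 1 by ring, Real.rpow_sub_one ha0.ne']
          field_simp; ring
        rw [← mul_pow, e1, mul_pow, mul_pow, mul_pow, ← Real.rpow_natCast ((a : ℝ) ^ (-c)),
          ← Real.rpow_mul ha0.le, ← Real.rpow_natCast ((q : ℝ) ^ (1 / (m : ℝ) + η - c)),
          ← Real.rpow_mul hq0.le]
        have e2 : (1 / (m : ℝ) + η - c) * m = 1 + m * η - m * c := by field_simp
        rw [e2, show -c * (m : ℝ) = -(m * c) by ring]
  have hsum : Summable fun a : ℕ => (a : ℝ) ^ (-(m * c)) := Real.summable_nat_rpow.2 (by linarith)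
  rw [← Finset.sum_fiberwise_of_maps_to hmaps]
  calc _ ≤ ∑ a ∈ Finset.Ico 1 (R + 1),
        8 ^ m * ((q : ℝ) ^ (1 + m * η - m * c) * ((q : ℝ) ^ (-1 - c)) ^ m) *
          (a : ℝ) ^ (-(m * c)) := Finset.sum_le_sum hfib
    _ = 8 ^ m * ((q : ℝ) ^ (1 + m * η - m * c) * ((q : ℝ) ^ (-1 - c)) ^ m) *
          ∑ a ∈ Finset.Ico 1 (R + 1), (a : ℝ) ^ (-(m * c)) := by rw [Finset.mul_sum]
    _ ≤ 8 ^ m * ((q : ℝ) ^ (1 + m * η - m * c) * ((q : ℝ) ^ (-1 - c)) ^ m) *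
          ∑' a : ℕ, (a : ℝ) ^ (-(m * c)) := by
        gcongr
        exact hsum.sum_le_tsum _ fun _ _ => by positivity
    _ = _ := by ring

open Filter Topology in
/-- There are arbitrarily large `Q` such that `(Q, 2 * Q]` contains at least `Q ^ (1 - η)` primes. -/
lemma exists_many_primes {η : ℝ} (hη : 0 < η) (hη1 : η < 1) (Q₀ : ℕ) :
    ∃ Q, Q₀ ≤ Q ∧ 1 ≤ Q ∧
      (Q : ℝ) ^ (1 - η) ≤ (((Finset.Ioc Q (2 * Q)).filter Nat.Prime).card : ℝ) := by
  by_contra! hcon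
  set k₀ := Q₀ with hk₀
  have hπ : ∀ Q, Nat.primeCounting (2 * Q) =
      Nat.primeCounting Q + ((Finset.Ioc Q (2 * Q)).filter Nat.Prime).card := by
    intro Q
    simp only [Nat.primeCounting, Nat.primeCounting']
    rw [Nat.count_eq_card_filter_range, Nat.count_eq_card_filter_range, ← Finset.card_union_of_disjoint]
    · congr 1
      ext x
      simp only [Finset.mem_filter, Finset.mem_range, Finset.mem_union, Finset.mem_Ioc]
      constructor
      · rintro ⟨h1, h2⟩
        by_cases h : x < Q + 1
        · exact Or.inl ⟨h, h2⟩
        · exact Or.inr ⟨⟨by omega, by omega⟩, h2⟩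
      · rintro (⟨h1, h2⟩ | ⟨⟨h1, h3⟩, h2⟩)
        · exact ⟨by omega, h2⟩
        · exact ⟨by omega, h2⟩
    · rw [Finset.disjoint_left]
      intro x hx hx'
      simp only [Finset.mem_filter, Finset.mem_range, Finset.mem_Ioc] at hx hx'
      omega
  have hind : ∀ n : ℕ, (Nat.primeCounting (2 ^ (k₀ + n)) : ℝ) ≤
      Nat.primeCounting (2 ^ k₀) + n * ((2 : ℝ) ^ (k₀ + n)) ^ (1 - η) := by
    intro n
    induction n with
    | zero => simp
    | succ n ih =>
      rw [← add_assoc, pow_succ', hπ]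
      have h1 := hcon (2 ^ (k₀ + n))
        ((Nat.lt_two_pow_self (n := k₀)).le.trans (Nat.pow_le_pow_right (by norm_num) (by omega)))
        Nat.one_le_two_pow
      push_cast at h1 ⊢
      have h2 : ((2 : ℝ) ^ (k₀ + n)) ^ (1 - η) ≤ ((2 : ℝ) ^ (k₀ + n + 1)) ^ (1 - η) := by
        refine Real.rpow_le_rpow (by positivity) ?_ (by linarith)
        exact pow_le_pow_right₀ (by norm_num) (by omega)
      nlinarith
  set C : ℝ := ((Nat.primeCounting (2 ^ k₀) : ℕ) : ℝ) with hC
  set g : ℝ → ℝ := fun x => C * (Real.log x * x ^ (-1 : ℝ)) +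
    (1 / Real.log 2) * ((Real.log x) ^ (2 : ℝ) * x ^ (-η)) + 2 * (Real.log x * x ^ (-1 : ℝ)) with hg
  have hglim : Tendsto g atTop (𝓝 0) := by
    have l1 : Tendsto (fun x : ℝ => Real.log x * x ^ (-1 : ℝ)) atTop (𝓝 0) := by
      have := (isLittleO_log_rpow_atTop (r := 1) one_pos).tendsto_div_nhds_zero
      refine this.congr' ?_
      filter_upwards [eventually_gt_atTop 0] with x hx
      rw [Real.rpow_neg hx.le, div_eq_mul_inv]
    have l2 : Tendsto (fun x : ℝ => (Real.log x) ^ (2 : ℝ) * x ^ (-η)) atTop (𝓝 0) := by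
      have := (isLittleO_log_rpow_rpow_atTop (s := η) 2 hη).tendsto_div_nhds_zero
      refine this.congr' ?_
      filter_upwards [eventually_gt_atTop 0] with x hx
      rw [Real.rpow_neg hx.le, div_eq_mul_inv]
    have := ((l1.const_mul C).add (l2.const_mul (1 / Real.log 2))).add (l1.const_mul 2)
    simp only [mul_zero, add_zero] at this
    exact this
  have hseq : Tendsto (fun n : ℕ => (2 : ℝ) ^ (k₀ + n)) atTop atTop := by
    have := tendsto_pow_atTop_atTop_of_one_lt (r := (2 : ℝ)) (by norm_num)
    exact this.comp (tendsto_add_atTop_nat k₀ |>.congr fun n => by ring)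
  have hev := (hglim.comp hseq).eventually_lt_const (show (0 : ℝ) < Real.log 2 from
    Real.log_pos (by norm_num))
  obtain ⟨n, hn, hn1⟩ := (hev.and (eventually_ge_atTop 1)).exists
  set x : ℝ := (2 : ℝ) ^ (k₀ + n) with hx
  have hx2 : 2 ≤ x := by
    calc (2 : ℝ) = 2 ^ 1 := by norm_num
      _ ≤ x := pow_le_pow_right₀ (by norm_num) (by omega)
  have hx0 : 0 < x := by linarith
  have hlx : 0 < Real.log x := Real.log_pos (by linarith)
  have hl2 : 0 < Real.log 2 := Real.log_pos (by norm_num)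
  have hpi := Chebyshev.pi_ge (2 ^ (k₀ + n))
  push_cast at hpi
  rw [← hx, div_le_iff₀ hlx] at hpi
  have hlog1 : Real.log (x + 1) ≤ 2 * Real.log x := by
    rw [← Real.log_rpow hx0]
    refine Real.log_le_log (by linarith) ?_
    norm_num
    nlinarith
  have hnlog : (n : ℝ) ≤ Real.log x / Real.log 2 := by
    rw [hx, Real.log_pow, le_div_iff₀ hl2]
    push_cast
    have : (0 : ℝ) ≤ k₀ := Nat.cast_nonneg _
    nlinarith
  have h1 := hind n
  rw [← hx] at h1
  have h2 : (Nat.primeCounting (2 ^ (k₀ + n)) : ℝ) ≤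
      C + Real.log x / Real.log 2 * x ^ (1 - η) := h1.trans (by gcongr)
  have h3 : x * Real.log 2 ≤ g x * x := by
    have h4 : x ^ (1 - η) = x ^ (-η) * x := by
      rw [← Real.rpow_add_one hx0.ne']; congr 1; ring
    rw [h4] at h2
    have h5 : x ^ (-1 : ℝ) * x = 1 := by
      rw [← Real.rpow_add_one hx0.ne']; simp
    have h6 : g x * x = C * Real.log x * (x ^ (-1 : ℝ) * x) +
      (Real.log x / Real.log 2 * (x ^ (-η) * x)) * Real.log x
        + 2 * Real.log x * (x ^ (-1 : ℝ) * x) := by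
      simp only [hg]
      rw [Real.rpow_two]
      ring
    rw [h6, h5]
    have h7 := mul_le_mul_of_nonneg_right h2 hlx.le
    linarith
  have h8 : g x < Real.log 2 := hn
  nlinarith

/-- The closed cube of points at distance comparable to `q ^ (-1 - c)` from `p / q`, on one side
of `p / q` in each coordinate. -/
def cell {m : ℕ} (c : ℝ) (q : ℕ) (p : Fin m → ℤ) : Set (Fin m → ℝ) :=
  {x | ∀ i, x i - p i / q ∈ Icc (1 / 4 * (q : ℝ) ^ (-1 - c)) (3 / 4 * (q : ℝ) ^ (-1 - c))}

open Classical in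
/-- The total weight of the sets `U i` that meet `B`. -/
def hitMass {X : Type*} (U : ℕ → Set X) (w : ℕ → ENNReal) (B : Set X) : ENNReal :=
  ∑' i, if (U i ∩ B).Nonempty then w i else 0

open Classical in
lemma exists_hitMass_lt {X κ : Type*} (F : Finset κ) (B : κ → Set X) (B₀ : Set X)
    (hB : ∀ k ∈ F, B k ⊆ B₀) (U : ℕ → Set X) (w : ℕ → ENNReal) (θ K : ENNReal)
    (hK : ∀ i, (U i ∩ B₀).Nonempty →
      ((F.filter fun k => (U i ∩ B k).Nonempty).card : ENNReal) * min (w i) θ ≤ K * w i)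
    (hlt : K * hitMass U w B₀ < F.card * θ) : ∃ k ∈ F, hitMass U w (B k) < θ := by
  by_contra! hcon
  refine hlt.not_ge ?_
  have h1 : ∀ k ∈ F, θ ≤ ∑' i, if (U i ∩ B k).Nonempty then min (w i) θ else 0 := by
    intro k hk
    by_cases h : ∃ i, (U i ∩ B k).Nonempty ∧ θ ≤ w i
    · obtain ⟨i, hi, hw⟩ := h
      refine le_trans ?_ (ENNReal.le_tsum i)
      rw [if_pos hi, min_eq_right hw]
    · push Not at h
      refine (hcon k hk).trans (le_of_eq (tsum_congr fun i => ?_))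
      split_ifs with hi
      · rw [min_eq_left (h i hi).le]
      · rfl
  calc (F.card : ENNReal) * θ = ∑ _k ∈ F, θ := by simp
    _ ≤ ∑ k ∈ F, ∑' i, (if (U i ∩ B k).Nonempty then min (w i) θ else 0) := Finset.sum_le_sum h1
    _ = ∑' i, ∑ k ∈ F, (if (U i ∩ B k).Nonempty then min (w i) θ else 0) :=
        (Summable.tsum_finsetSum fun _ _ => ENNReal.summable).symm
    _ ≤ ∑' i, K * (if (U i ∩ B₀).Nonempty then w i else 0) := by
        refine ENNReal.tsum_le_tsum fun i => ?_
        by_cases h : (U i ∩ B₀).Nonempty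
        · rw [if_pos h]
          refine le_trans (le_of_eq ?_) (hK i h)
          rw [← Finset.sum_filter]; simp
        · rw [if_neg h, Finset.sum_eq_zero]
          · exact zero_le
          intro k hk
          rw [if_neg]
          exact fun h' => h (h'.mono (inter_subset_inter_right _ (hB k hk)))
    _ = K * hitMass U w B₀ := by rw [hitMass, ENNReal.tsum_mul_left]

lemma hitMass_mono {X : Type*} (U : ℕ → Set X) (w : ℕ → ENNReal) (B : Set X) :
    hitMass U w B ≤ ∑' i, w i := by
  classical
  refine ENNReal.tsum_le_tsum fun i => ?_
  split_ifs <;> simp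

lemma le_hitMass {X : Type*} (U : ℕ → Set X) (w : ℕ → ENNReal) (B : Set X) {i : ℕ}
    (hi : (U i ∩ B).Nonempty) : w i ≤ hitMass U w B := by
  classical
  refine le_trans ?_ (ENNReal.le_tsum i)
  rw [if_pos hi]

open Classical in
/-- Number of cells, with `δ`-separated base points, which meet a set `U` of diameter at most
`d`. -/
lemma card_hit_le {m : ℕ} {κ : Type*} (F : Finset κ) (f : κ → Fin m → ℝ)
    (B : κ → Set (Fin m → ℝ)) {ε δ d X : ℝ} (hδ : 0 < δ) (hX0 : 0 ≤ X)
    (hB : ∀ k ∈ F, ∀ x ∈ B k, ∀ i, |x i - f k i| ≤ ε)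
    (hsep : ∀ a ∈ F, ∀ b ∈ F, a ≠ b → ∃ i, δ ≤ |f a i - f b i|)
    (U : Set (Fin m → ℝ)) (hU : ∀ x ∈ U, ∀ y ∈ U, ∀ i, |x i - y i| ≤ d) (hX : d + ε ≤ X) :
    ((F.filter fun k => (U ∩ B k).Nonempty).card : ℝ) ≤ (2 * X / δ + 2) ^ m := by
  rcases (F.filter fun k => (U ∩ B k).Nonempty).eq_empty_or_nonempty with he | ⟨k, hk⟩
  · rw [he]; simp; positivity
  obtain ⟨u, hu, -⟩ := (Finset.mem_filter.1 hk).2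
  refine card_le_of_separated _ f hδ hX0 u ?_ ?_
  · intro a ha i
    obtain ⟨haF, x, hx, hxa⟩ := Finset.mem_filter.1 ha
    have h1 := abs_le.1 (hU x hx u hu i)
    have h2 := abs_le.1 (hB a haF x hxa i)
    rw [abs_le]
    constructor <;> linarith [h1.1, h1.2, h2.1, h2.2]
  · intro a ha b hb
    exact hsep a (Finset.mem_filter.1 ha).1 b (Finset.mem_filter.1 hb).1

open Classical in
lemma card_hit_le_one {m : ℕ} {κ : Type*} (F : Finset κ) (f : κ → Fin m → ℝ)
    (B : κ → Set (Fin m → ℝ)) {ε δ d : ℝ}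
    (hB : ∀ k ∈ F, ∀ x ∈ B k, ∀ i, |x i - f k i| ≤ ε)
    (hsep : ∀ a ∈ F, ∀ b ∈ F, a ≠ b → ∃ i, δ ≤ |f a i - f b i|)
    (U : Set (Fin m → ℝ)) (hU : ∀ x ∈ U, ∀ y ∈ U, ∀ i, |x i - y i| ≤ d) (hd : d + 2 * ε < δ) :
    ((F.filter fun k => (U ∩ B k).Nonempty).card : ℝ) ≤ 1 := by
  suffices h : (F.filter fun k => (U ∩ B k).Nonempty).card ≤ 1 by exact_mod_cast h
  rw [Finset.card_le_one]
  intro a ha b hb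
  obtain ⟨haF, x, hx, hxa⟩ := Finset.mem_filter.1 ha
  obtain ⟨hbF, y, hy, hyb⟩ := Finset.mem_filter.1 hb
  by_contra hne
  obtain ⟨i, hi⟩ := hsep a haF b hbF hne
  have h1 := abs_le.1 (hU x hx y hy i)
  have h2 := abs_le.1 (hB a haF x hxa i)
  have h3 := abs_le.1 (hB b hbF y hyb i)
  have : |f a i - f b i| ≤ d + 2 * ε := by
    rw [abs_le]
    constructor <;> linarith [h1.1, h1.2, h2.1, h2.2, h3.1, h3.2]
  linarith

lemma abs_sub_le_of_mem_cell {m : ℕ} {c : ℝ} {q : ℕ} {p : Fin m → ℤ} {x : Fin m → ℝ}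
    (hx : x ∈ cell c q p) (i : Fin m) : |x i - p i / q| ≤ 3 / 4 * (q : ℝ) ^ (-1 - c) := by
  obtain ⟨h1, h2⟩ := hx i
  have : (0 : ℝ) ≤ (q : ℝ) ^ (-1 - c) := by positivity
  rw [abs_le]
  constructor <;> linarith

lemma le_abs_sub_of_mem_cell {m : ℕ} {c : ℝ} {q : ℕ} {p : Fin m → ℤ} {x : Fin m → ℝ}
    (hx : x ∈ cell c q p) (i : Fin m) : 1 / 4 * (q : ℝ) ^ (-1 - c) ≤ |x i - p i / q| :=
  (hx i).1.trans (le_abs_self _)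

/-- Two distinct good fractions with prime denominators in `(Q, 2 * Q]` are well separated. -/
lemma IsGood.separated {m : ℕ} (hm : m ≠ 0) {η : ℝ} (hη : 0 < η) {Q q q' : ℕ} {p p' : Fin m → ℤ}
    (hp : IsGood η q p) (hp' : IsGood η q' p') (hQ : 1 ≤ Q) (hq : q ≤ 2 * Q) (hq' : q' ≤ 2 * Q)
    (hne : (⟨q, p⟩ : Σ _ : ℕ, Fin m → ℤ) ≠ ⟨q', p'⟩) :
    ∃ i, ((2 * Q : ℕ) : ℝ) ^ (-1 - 1 / (m : ℝ) - η) ≤ |(p i : ℝ) / q - p' i / q'| := by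
  have hm0 : (0 : ℝ) < m := by exact_mod_cast Nat.pos_of_ne_zero hm
  have key : ∀ (q q' : ℕ) (p p' : Fin m → ℤ), IsGood η q p → IsGood η q' p' → q ≤ 2 * Q →
      q' < q → ∃ i, ((2 * Q : ℕ) : ℝ) ^ (-1 - 1 / (m : ℝ) - η) ≤ |(p i : ℝ) / q - p' i / q'| := by
    intro q q' p p' hp hp' hq hlt
    have hq0 : (0 : ℝ) < q := by exact_mod_cast hp.1.pos
    have hq0' : (0 : ℝ) < q' := by exact_mod_cast hp'.1.pos
    obtain ⟨i, hi⟩ := hp.2 q' hp'.1.pos hlt p'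
    refine ⟨i, ?_⟩
    have h1 : |(q' : ℝ) * p i - q * p' i| = q * q' * |(p i : ℝ) / q - p' i / q'| := by
      rw [← abs_of_pos (mul_pos hq0 hq0'), ← abs_mul]
      congr 1; field_simp
    have hqq : (q' : ℝ) ≤ q := by exact_mod_cast hlt.le
    have h2 : (q : ℝ) ^ (1 - 1 / (m : ℝ) - η) = q * q * (q : ℝ) ^ (-1 - 1 / (m : ℝ) - η) := by
      rw [show 1 - 1 / (m : ℝ) - η = (-1 - 1 / (m : ℝ) - η) + 1 + 1 by ring,
        Real.rpow_add_one hq0.ne', Real.rpow_add_one hq0.ne']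
      ring
    have h3 : (q : ℝ) ^ (-1 - 1 / (m : ℝ) - η) ≤ |(p i : ℝ) / q - p' i / q'| := by
      rw [h1, h2] at hi
      have h4 : (q : ℝ) * q' * |(p i : ℝ) / q - p' i / q'| ≤
          q * q * |(p i : ℝ) / q - p' i / q'| := by gcongr
      exact (lt_of_mul_lt_mul_left (hi.trans_le h4) (by positivity)).le
    refine le_trans (Real.rpow_le_rpow_of_nonpos hq0 (by exact_mod_cast hq) ?_) h3
    have : 0 ≤ 1 / (m : ℝ) := by positivity
    linarith
  rcases lt_trichotomy q q' with h | h | h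
  · obtain ⟨i, hi⟩ := key q' q p' p hp' hp hq' h
    exact ⟨i, by rwa [abs_sub_comm]⟩
  · subst h
    have hpp : p ≠ p' := fun h => hne (by rw [h])
    obtain ⟨i, hi⟩ := Function.ne_iff.1 hpp
    refine ⟨i, ?_⟩
    have hq0 : (0 : ℝ) < q := by exact_mod_cast hp.1.pos
    have h1 : (1 : ℝ) ≤ |((p i - p' i : ℤ) : ℝ)| := by
      exact_mod_cast Int.one_le_abs (sub_ne_zero.2 hi)
    push_cast at h1
    have hQ1 : (1 : ℝ) ≤ ((2 * Q : ℕ) : ℝ) := by exact_mod_cast (by omega : 1 ≤ 2 * Q)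
    calc ((2 * Q : ℕ) : ℝ) ^ (-1 - 1 / (m : ℝ) - η) ≤ ((2 * Q : ℕ) : ℝ) ^ (-1 : ℝ) := by
          refine Real.rpow_le_rpow_of_exponent_le hQ1 ?_
          have : 0 ≤ 1 / (m : ℝ) := by positivity
          linarith
      _ ≤ (q : ℝ) ^ (-1 : ℝ) :=
          Real.rpow_le_rpow_of_nonpos hq0 (by exact_mod_cast hq) (by norm_num)
      _ = 1 / q := by rw [Real.rpow_neg_one, one_div]
      _ ≤ |(p i : ℝ) - p' i| / q := by gcongr
      _ = _ := by rw [← sub_div, abs_div, abs_of_pos hq0]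
  · exact key q q' p p' hp hp' hq h

open Classical in
/-- Number of cells of a well separated family of good fractions meeting a set of diameter
at most `d`, weighted by `min (d ^ s) θ`. -/
lemma card_hit_mul_min_le {m : ℕ} (hm : m ≠ 0) {c η s θ ρ : ℝ} (hη : 0 < η) (hc : 0 < c)
    (hsm : s < m) (hθ : 0 < θ) {Q : ℕ} (hQ : 1 ≤ Q)
    (hQsep : 4 * (Q : ℝ) ^ (-1 - c) ≤ ((2 * Q : ℕ) : ℝ) ^ (-1 - 1 / (m : ℝ) - η))
    (F : Finset (Σ _ : ℕ, Fin m → ℤ)) (hF : ∀ k ∈ F, k.1 ∈ Finset.Ioc Q (2 * Q) ∧ IsGood η k.1 k.2)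
    (U : Set (Fin m → ℝ)) {d : ℝ} (hd : 0 < d) (hdρ : d ≤ ρ)
    (hU : ∀ x ∈ U, ∀ y ∈ U, ∀ i, |x i - y i| ≤ d) :
    ((F.filter fun k => (U ∩ cell c k.1 k.2).Nonempty).card : ℝ) * min (d ^ s) θ ≤
      (θ * ((((Finset.Ioc Q (2 * Q)).filter Nat.Prime).card : ℝ) * (10 * Q) ^ m * ρ ^ (m - s) +
        (8 / ((2 * Q : ℕ) : ℝ) ^ (-1 - 1 / (m : ℝ) - η)) ^ m * (Q : ℝ) ^ (-(m - s))) + 1) *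
        d ^ s := by
  have hm0 : (0 : ℝ) < m := by exact_mod_cast Nat.pos_of_ne_zero hm
  have hρ : 0 < ρ := hd.trans_le hdρ
  have hQ0 : (0 : ℝ) < Q := by exact_mod_cast hQ
  set δ : ℝ := ((2 * Q : ℕ) : ℝ) ^ (-1 - 1 / (m : ℝ) - η) with hδdef
  set ε : ℝ := (Q : ℝ) ^ (-1 - c) with hε
  have hδ : 0 < δ := by
    have : (0 : ℝ) < ((2 * Q : ℕ) : ℝ) := by positivity
    positivity
  have hε0 : 0 < ε := by positivity
  set h : ℝ := (((Finset.Ioc Q (2 * Q)).filter Nat.Prime).card : ℝ) with hh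
  have hh0 : 0 ≤ h := Nat.cast_nonneg _
  set f : (Σ _ : ℕ, Fin m → ℤ) → Fin m → ℝ := fun k i => (k.2 i : ℝ) / k.1 with hf
  have hB : ∀ k ∈ F, ∀ x ∈ cell c k.1 k.2, ∀ i, |x i - f k i| ≤ ε := by
    intro k hk x hx i
    have h1 := abs_sub_le_of_mem_cell hx i
    have h2 : (k.1 : ℝ) ^ (-1 - c) ≤ ε := by
      refine Real.rpow_le_rpow_of_nonpos hQ0 ?_ (by linarith)
      exact_mod_cast (Finset.mem_Ioc.1 (hF k hk).1).1.le
    linarith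
  have hsep : ∀ a ∈ F, ∀ b ∈ F, a ≠ b → ∃ i, δ ≤ |f a i - f b i| := by
    intro a ha b hb hne
    exact (hF a ha).2.separated hm hη (hF b hb).2 hQ (Finset.mem_Ioc.1 (hF a ha).1).2
      (Finset.mem_Ioc.1 (hF b hb).1).2 hne
  set n : ℝ := ((F.filter fun k => (U ∩ cell c k.1 k.2).Nonempty).card : ℝ) with hn
  have hn0 : 0 ≤ n := Nat.cast_nonneg _
  have hds : 0 < d ^ s := by positivity
  have hdm : d ^ m = d ^ ((m : ℝ) - s) * d ^ s := by
    rw [← Real.rpow_add hd, sub_add_cancel, Real.rpow_natCast]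
  set A : ℝ := h * (10 * Q) ^ m * ρ ^ ((m : ℝ) - s) with hA
  set B : ℝ := (8 / δ) ^ m * (Q : ℝ) ^ (-((m : ℝ) - s)) with hBdef
  have hA0 : 0 ≤ A := by positivity
  have hB0 : 0 ≤ B := by positivity
  rcases lt_or_ge d (δ / 2) with h1 | h1
  · have h2 : n ≤ 1 := card_hit_le_one F f (fun k => cell c k.1 k.2) hB hsep U hU
      (by linarith)
    calc n * min (d ^ s) θ ≤ 1 * d ^ s := by
          gcongr
          exact min_le_left _ _
      _ ≤ (θ * (A + B) + 1) * d ^ s := by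
          gcongr
          have : 0 ≤ θ * (A + B) := by positivity
          linarith
  have hεd : ε ≤ d := by linarith
  rcases lt_or_ge d (1 / Q) with h2 | h2
  · have h3 : n ≤ (8 * d / δ) ^ m := by
      have h4 := card_hit_le F f (fun k => cell c k.1 k.2) (X := 2 * d) hδ (by positivity) hB hsep
        U hU (by linarith)
      refine h4.trans ?_
      gcongr
      have h5 : 1 ≤ 2 * d / δ := by rw [one_le_div hδ]; linarith
      have h6 : 8 * d / δ = 2 * (2 * d) / δ + 2 * (2 * d / δ) := by ring
      linarith
    calc n * min (d ^ s) θ ≤ (8 * d / δ) ^ m * θ := by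
          gcongr
          exact min_le_right _ _
      _ = θ * ((8 / δ) ^ m * d ^ ((m : ℝ) - s)) * d ^ s := by
          rw [show 8 * d / δ = 8 / δ * d by ring, mul_pow, hdm]; ring
      _ ≤ θ * B * d ^ s := by
          rw [hBdef]
          gcongr θ * ((8 / δ) ^ m * ?_) * d ^ s
          calc d ^ ((m : ℝ) - s) ≤ (1 / (Q : ℝ)) ^ ((m : ℝ) - s) :=
                Real.rpow_le_rpow hd.le h2.le (by linarith)
            _ = _ := by rw [Real.rpow_neg hQ0.le, one_div, Real.inv_rpow hQ0.le]
      _ ≤ (θ * (A + B) + 1) * d ^ s := by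
          gcongr
          have : 0 ≤ θ * A := by positivity
          linarith
  · have h3 : n ≤ h * (10 * (d * Q)) ^ m := by
      have hmaps : ∀ k ∈ F.filter (fun k => (U ∩ cell c k.1 k.2).Nonempty),
          k.1 ∈ (Finset.Ioc Q (2 * Q)).filter Nat.Prime := fun k hk =>
        Finset.mem_filter.2 ⟨(hF k (Finset.mem_filter.1 hk).1).1,
          (hF k (Finset.mem_filter.1 hk).1).2.1⟩
      rw [hn, Finset.card_eq_sum_card_fiberwise hmaps, Nat.cast_sum, hh, ← nsmul_eq_mul]
      refine Finset.sum_le_card_nsmul _ _ _ fun q hq => ?_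
      rw [Finset.filter_comm]
      have hδ' : (0 : ℝ) < 1 / (2 * Q) := by positivity
      have h4 := card_hit_le (F.filter fun k => k.1 = q) f (fun k => cell c k.1 k.2)
        (X := 2 * d) hδ' (by positivity) (fun k hk => hB k (Finset.mem_filter.1 hk).1) ?_
        U hU (by linarith)
      · refine h4.trans ?_
        gcongr
        have h5 : 1 ≤ d * Q := by rwa [div_le_iff₀ hQ0] at h2
        have h6 : 2 * (2 * d) / (1 / (2 * (Q : ℝ))) = 8 * (d * Q) := by field_simp; ring
        linarith
      · rintro ⟨q₁, p₁⟩ ha ⟨q₂, p₂⟩ hb hne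
        obtain ⟨ha1, rfl⟩ := Finset.mem_filter.1 ha
        obtain ⟨hb1, hb2⟩ := Finset.mem_filter.1 hb
        dsimp only at hb2
        subst hb2
        have hpp : p₁ ≠ p₂ := fun h => hne (by rw [h])
        obtain ⟨i, hi⟩ := Function.ne_iff.1 hpp
        refine ⟨i, ?_⟩
        have hg := (hF _ ha1)
        have hq0 : (0 : ℝ) < q₂ := by exact_mod_cast hg.2.1.pos
        have hq2 : (q₂ : ℝ) ≤ 2 * Q := by exact_mod_cast (Finset.mem_Ioc.1 hg.1).2
        have h1 : (1 : ℝ) ≤ |((p₁ i - p₂ i : ℤ) : ℝ)| := by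
          exact_mod_cast Int.one_le_abs (sub_ne_zero.2 hi)
        push_cast at h1
        calc 1 / (2 * (Q : ℝ)) ≤ |(p₁ i : ℝ) - p₂ i| / q₂ := by gcongr
          _ = _ := by simp only [hf]; rw [← sub_div, abs_div, abs_of_pos hq0]
    calc n * min (d ^ s) θ ≤ (h * (10 * (d * Q)) ^ m) * θ := by
          gcongr
          exact min_le_right _ _
      _ = θ * (h * (10 * Q) ^ m * d ^ ((m : ℝ) - s)) * d ^ s := by
          rw [show 10 * (d * (Q : ℝ)) = 10 * Q * d by ring, mul_pow _ d, hdm]; ring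
      _ ≤ θ * A * d ^ s := by
          rw [hA]
          gcongr θ * (h * (10 * Q) ^ m * ?_) * d ^ s
          exact Real.rpow_le_rpow hd.le hdρ (by linarith)
      _ ≤ (θ * (A + B) + 1) * d ^ s := by
          gcongr
          have : 0 ≤ θ * B := by positivity
          linarith

open Filter Topology in
lemma eventually_mul_rpow_lt {α β C D : ℝ} (h : α < β) (hD : 0 < D) :
    ∀ᶠ Q : ℕ in atTop, C * (Q : ℝ) ^ α < D * (Q : ℝ) ^ β := by
  have h1 : Tendsto (fun Q : ℕ => C * (Q : ℝ) ^ (-(β - α))) atTop (𝓝 (C * 0)) :=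
    ((tendsto_rpow_neg_atTop (by linarith)).comp tendsto_natCast_atTop_atTop).const_mul _
  rw [mul_zero] at h1
  filter_upwards [h1.eventually_lt_const hD, eventually_gt_atTop 0] with Q hQ hQ0
  have hQ0' : (0 : ℝ) < Q := by exact_mod_cast hQ0
  calc C * (Q : ℝ) ^ α = C * (Q : ℝ) ^ (-(β - α)) * (Q : ℝ) ^ β := by
        rw [mul_assoc, ← Real.rpow_add hQ0']; congr 2; ring
    _ < _ := by gcongr

open Filter Topology in
/-- For large `Q`, the cells of level `Q` are numerous and small enough for the counting
argument. -/
lemma eventually_count {m : ℕ} (hm : m ≠ 0) {c η s t ρ E : ℝ} (hρ : 0 < ρ) (hE : 0 < E)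
    (hc : m * η < m * c - 1) (hη : (m + 1) * η < m - s) (ht : (1 + c) * t < m + 1 - η) :
    ∀ᶠ Q : ℕ in atTop, 4 * (Q : ℝ) ^ (-1 - c) ≤ ((2 * Q : ℕ) : ℝ) ^ (-1 - 1 / (m : ℝ) - η) ∧
      (8 / ((2 * Q : ℕ) : ℝ) ^ (-1 - 1 / (m : ℝ) - η)) ^ m * (Q : ℝ) ^ (-(m - s)) * ρ ^ t <
        E * (Q : ℝ) ^ (1 - η) * (ρ ^ m * (Q : ℝ) ^ m) ∧
      ρ ^ t < E * (Q : ℝ) ^ (1 - η) * (ρ ^ m * (Q : ℝ) ^ m) *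
        (1 / 4 * ((2 * Q : ℕ) : ℝ) ^ (-1 - c)) ^ t := by
  have hm0 : (0 : ℝ) < m := by exact_mod_cast Nat.pos_of_ne_zero hm
  have e1 := eventually_mul_rpow_lt (α := -1 - c) (β := -1 - 1 / (m : ℝ) - η) (C := 4)
    (D := (2 : ℝ) ^ (-1 - 1 / (m : ℝ) - η)) (by
      have : 1 / (m : ℝ) + η < c := by
        rw [← sub_pos] at hc ⊢
        have : c - (1 / (m : ℝ) + η) = (m * c - 1 - m * η) / m := by field_simp; ring
        rw [this]; positivity
      linarith) (by positivity)
  have e2 := eventually_mul_rpow_lt (α := (1 + 1 / (m : ℝ) + η) * m - (m - s)) (β := 1 - η + m)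
    (C := (8 / (2 : ℝ) ^ (-1 - 1 / (m : ℝ) - η)) ^ m * ρ ^ t) (D := E * ρ ^ m) (by
      have : (1 + 1 / (m : ℝ) + η) * m = m + 1 + m * η := by field_simp
      rw [this]; linarith) (by positivity)
  have e3 := eventually_mul_rpow_lt (α := 0) (β := 1 - η + m + (-1 - c) * t)
    (C := ρ ^ t) (D := E * ρ ^ m * (1 / 4 * (2 : ℝ) ^ (-1 - c)) ^ t) (by linarith) (by positivity)
  filter_upwards [e1, e2, e3, eventually_gt_atTop 0] with Q h1 h2 h3 hQ
  have hQ0 : (0 : ℝ) < Q := by exact_mod_cast hQ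
  push_cast
  refine ⟨?_, ?_, ?_⟩
  · rw [Real.mul_rpow (by norm_num) hQ0.le]
    exact h1.le
  · calc _ = (8 / (2 : ℝ) ^ (-1 - 1 / (m : ℝ) - η)) ^ m * ρ ^ t *
        (Q : ℝ) ^ ((1 + 1 / (m : ℝ) + η) * m - (m - s)) := by
          rw [Real.mul_rpow (by norm_num) hQ0.le, ← div_div, div_eq_mul_inv _ ((Q : ℝ) ^ _),
            ← Real.rpow_neg hQ0.le, mul_pow, ← Real.rpow_natCast ((Q : ℝ) ^ _),
            ← Real.rpow_mul hQ0.le, sub_eq_add_neg _ ((m : ℝ) - s), Real.rpow_add hQ0,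
            show -(-1 - 1 / (m : ℝ) - η) = 1 + 1 / (m : ℝ) + η by ring]
          ring
      _ < _ := h2
      _ = _ := by rw [Real.rpow_add hQ0, Real.rpow_natCast]; ring
  · rw [Real.rpow_zero, mul_one] at h3
    refine h3.trans_eq ?_
    rw [Real.mul_rpow (by norm_num) hQ0.le, ← mul_assoc (1 / 4 : ℝ),
      Real.mul_rpow (x := 1 / 4 * (2 : ℝ) ^ (-1 - c)) (by positivity) (by positivity),
      ← Real.rpow_mul hQ0.le, Real.rpow_add hQ0,
      Real.rpow_add hQ0, Real.rpow_natCast]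
    ring

open Filter Topology in
/-- There are sums over tails of `∑ j ^ (-m c)` as small as we like. -/
lemma exists_tail_le {m : ℕ} {c : ℝ} (hc : 1 < m * c) {ε : ℝ} (hε : 0 < ε) (q : ℕ) :
    ∃ R, q ≤ R ∧ ∀ n, 3 ^ m * ∑ j ∈ Finset.Ico R n, (j : ℝ) ^ (-(m * c)) ≤ ε := by
  have hsum : Summable fun a : ℕ => (a : ℝ) ^ (-(m * c)) := Real.summable_nat_rpow.2 (by linarith)
  have h := hsum.hasSum.tendsto_sum_nat
  have hε' : 0 < ε / 3 ^ m := by positivity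
  obtain ⟨R, hR, hqR⟩ := ((h.eventually_const_lt (show
    ∑' a : ℕ, (a : ℝ) ^ (-(m * c)) - ε / 3 ^ m < _ by linarith)).and (eventually_ge_atTop q)).exists
  refine ⟨R, hqR, fun n => ?_⟩
  rw [← le_div_iff₀' (by positivity)]
  rcases le_total n R with hn | hn
  · rw [Finset.Ico_eq_empty_of_le hn]; simp; positivity
  · have h1 : ∑ j ∈ Finset.range n, (j : ℝ) ^ (-(m * c)) ≤ ∑' a : ℕ, (a : ℝ) ^ (-(m * c)) :=
      hsum.sum_le_tsum _ fun _ _ => by positivity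
    have h2 := Finset.sum_range_add_sum_Ico (fun j : ℕ => (j : ℝ) ^ (-(m * c))) hn
    linarith

/-- Points of a nested pair of cells are badly approximated by the fractions with denominators
between those of the two cells. -/
lemma exists_le_abs_sub_of_mem_cell {m : ℕ} (hm : m ≠ 0) {c : ℝ} (hc : 0 < c) {q q' R : ℕ}
    {p p' : Fin m → ℤ} (hq : 0 < q) (hq' : 0 < q') {x : Fin m → ℝ}
    (hx : x ∈ cell c q p) (hx' : x ∈ cell c q' p')
    (hs : 3 * (q' : ℝ) ^ (-1 - c) ≤ (R : ℝ) ^ (-1 - c))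
    (hfar : ∀ j : ℕ, R ≤ j → j < q' → ∀ v : Fin m → ℤ,
      ∃ i, (q' : ℝ) * (j : ℝ) ^ (-c) < |(j : ℝ) * p' i - q' * v i|)
    (hD : ∀ d ∈ nearby c q p R,
      ∃ i, 1 / 2 * (d.1 : ℝ) ^ (-1 - c) < |(p' i : ℝ) / q' - d.2 i / d.1|)
    {j : ℕ} (hj : q ≤ j) (hj' : j < q') (v : Fin m → ℤ) :
    ∃ i, 1 / 4 * (j : ℝ) ^ (-1 - c) ≤ |x i - v i / j| := by
  have hq0 : (0 : ℝ) < q := by exact_mod_cast hq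
  have hj0 : (0 : ℝ) < j := by exact_mod_cast hq.trans_le hj
  have hq0' : (0 : ℝ) < q' := by exact_mod_cast hq'
  have hjq : (j : ℝ) ^ (-1 - c) ≤ (q : ℝ) ^ (-1 - c) :=
    Real.rpow_le_rpow_of_nonpos hq0 (by exact_mod_cast hj) (by linarith)
  have hqj' : (q' : ℝ) ^ (-1 - c) ≤ (j : ℝ) ^ (-1 - c) :=
    Real.rpow_le_rpow_of_nonpos hj0 (by exact_mod_cast hj'.le) (by linarith)
  have hpos : 0 < (j : ℝ) ^ (-1 - c) := by positivity
  rcases lt_or_ge j R with hjR | hjR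
  · by_cases hmem : (⟨j, v⟩ : Σ _ : ℕ, Fin m → ℤ) ∈ nearby c q p R
    · obtain ⟨i, hi⟩ := hD _ hmem
      refine ⟨i, ?_⟩
      have h1 := abs_sub_le_of_mem_cell hx' i
      have h2 : (R : ℝ) ^ (-1 - c) ≤ (j : ℝ) ^ (-1 - c) :=
        Real.rpow_le_rpow_of_nonpos hj0 (by exact_mod_cast hjR.le) (by linarith)
      have h3 := abs_sub_le ((p' i : ℝ) / q') (x i) (v i / j)
      rw [abs_sub_comm _ (x i)] at h3
      dsimp only at hi
      linarith
    · by_cases heq : ∀ i, (j : ℤ) * p i - q * v i = 0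
      · refine ⟨⟨0, Nat.pos_of_ne_zero hm⟩, ?_⟩
        have h1 := le_abs_sub_of_mem_cell hx ⟨0, Nat.pos_of_ne_zero hm⟩
        have h2 : (j : ℝ) * p ⟨0, Nat.pos_of_ne_zero hm⟩ - q * v ⟨0, Nat.pos_of_ne_zero hm⟩ = 0 := by
          exact_mod_cast heq ⟨0, Nat.pos_of_ne_zero hm⟩
        have h3 : (v ⟨0, Nat.pos_of_ne_zero hm⟩ : ℝ) / j = p ⟨0, Nat.pos_of_ne_zero hm⟩ / q := by
          rw [div_eq_div_iff hj0.ne' hq0.ne']; linarith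
        rw [h3]
        linarith
      · have hbox : v ∉ intBox (fun i => (j : ℝ) * (p i / q)) (j * (2 * (q : ℝ) ^ (-1 - c))) := by
          intro h
          refine hmem ?_
          simp only [nearby, Finset.mem_sigma, Finset.mem_Ico, Finset.mem_filter]
          exact ⟨⟨hj, hjR⟩, h, heq⟩
        rw [mem_intBox] at hbox
        push Not at hbox
        obtain ⟨i, hi⟩ := hbox
        refine ⟨i, ?_⟩
        have h1 : |(v i : ℝ) - j * (p i / q)| = j * |(v i : ℝ) / j - p i / q| := by
          rw [← abs_of_pos hj0, ← abs_mul, abs_of_pos hj0]; congr 1; field_simp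
        rw [h1] at hi
        have h2 := lt_of_mul_lt_mul_left hi hj0.le
        have h3 := abs_sub_le_of_mem_cell hx i
        have h4 := abs_sub_le ((v i : ℝ) / j) (x i) (p i / q)
        rw [abs_sub_comm _ (x i)] at h4
        linarith
  · obtain ⟨i, hi⟩ := hfar j hjR hj' v
    refine ⟨i, ?_⟩
    have h1 : |(j : ℝ) * p' i - q' * v i| = q' * (j * |(p' i : ℝ) / q' - v i / j|) := by
      rw [← mul_assoc, ← abs_of_pos (mul_pos hq0' hj0), ← abs_mul]
      congr 1; field_simp
    rw [h1] at hi
    have h2 := lt_of_mul_lt_mul_left hi hq0'.le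
    have h3 : (j : ℝ) ^ (-c) = j * (j : ℝ) ^ (-1 - c) := by
      rw [show -c = (-1 - c) + 1 by ring, Real.rpow_add_one hj0.ne', mul_comm]
    rw [h3] at h2
    have h4 := lt_of_mul_lt_mul_left h2 hj0.le
    have h5 := abs_sub_le_of_mem_cell hx' i
    have h6 := abs_sub_le ((p' i : ℝ) / q') (x i) (v i / j)
    rw [abs_sub_comm _ (x i)] at h6
    linarith

lemma cell_subset_cell {m : ℕ} {c : ℝ} {q q' : ℕ} {p p' : Fin m → ℤ}
    (h : ∀ i, |(p' i : ℝ) / q' - (p i / q + 1 / 2 * (q : ℝ) ^ (-1 - c))| ≤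
      1 / 8 * (q : ℝ) ^ (-1 - c)) (hs : (q' : ℝ) ^ (-1 - c) ≤ 1 / 8 * (q : ℝ) ^ (-1 - c)) :
    cell c q' p' ⊆ cell c q p := by
  intro x hx i
  have h1 := abs_le.1 (h i)
  have h2 := hx i
  have h3 : (0 : ℝ) ≤ (q' : ℝ) ^ (-1 - c) := by positivity
  exact ⟨by linarith [h1.1, h2.1], by linarith [h1.2, h2.2]⟩

lemma mul_rpow_le_of_le {m : ℕ} {h ρ Q E s t : ℝ} (hh : 0 ≤ h) (hρ : 0 < ρ) (hQ : 0 ≤ Q)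
    (hE : 10 ^ m * ρ ^ (t - s) ≤ E) :
    h * (10 * Q) ^ m * ρ ^ ((m : ℝ) - s) * ρ ^ t ≤ h * (E * (ρ ^ m * Q ^ m)) := by
  have h1 : ρ ^ ((m : ℝ) - s) * ρ ^ t = ρ ^ m * ρ ^ (t - s) := by
    rw [← Real.rpow_natCast, ← Real.rpow_add hρ, ← Real.rpow_add hρ]
    congr 1; ring
  calc _ = h * ((10 ^ m * ρ ^ (t - s)) * (ρ ^ m * Q ^ m)) := by
        rw [mul_assoc, h1, mul_pow]; ring
    _ ≤ _ := by gcongr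

lemma add_mul_lt_of_le {A B E N h n r θ : ℝ} (hθ : 0 < θ) (hA : A * r ≤ h * (E / 4 * N))
    (hB : B * r ≤ h * (E / 4 * N)) (hr : r < h * (E / 4 * N) * θ) (hn : h * (E * N) ≤ n)
    (h0 : 0 ≤ h * (E * N)) : (θ * (A + B) + 1) * r < n * θ := by
  have h1 := mul_le_mul_of_nonneg_left hA hθ.le
  have h2 := mul_le_mul_of_nonneg_left hB hθ.le
  have h3 := mul_le_mul_of_nonneg_right hn hθ.le
  have h4 := mul_nonneg h0 hθ.le
  linarith

open Filter Topology in
/-- Every good cell of small hitting mass contains a smaller one, all of whose points are badly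
approximated by the fractions with intermediate denominators. -/
lemma exists_next_cell {m : ℕ} (hm : m ≠ 0) {c η s t : ℝ} (hη : 0 < η) (hη1 : η < 1) (hs : 0 < s)
    (hst : s < t) (hc : m * η < m * c - 1) (hηs : (m + 1) * η < m - s)
    (ht : (1 + c) * t < m + 1 - η) :
    ∃ q₀ : ℕ, ∀ (q : ℕ) (p : Fin m → ℤ), q₀ ≤ q → IsGood η q p →
      ∀ (U : ℕ → Set (Fin m → ℝ)) (d : ℕ → ℝ), (∀ i, 0 < d i) →
      (∀ i, ∀ x ∈ U i, ∀ y ∈ U i, ∀ k, |x k - y k| ≤ d i) →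
      hitMass U (fun i => ENNReal.ofReal (d i ^ s)) (cell c q p) <
        ENNReal.ofReal ((1 / 4 * (q : ℝ) ^ (-1 - c)) ^ t) →
      ∃ (q' : ℕ) (p' : Fin m → ℤ), q < q' ∧ IsGood η q' p' ∧ cell c q' p' ⊆ cell c q p ∧
        hitMass U (fun i => ENNReal.ofReal (d i ^ s)) (cell c q' p') <
          ENNReal.ofReal ((1 / 4 * (q' : ℝ) ^ (-1 - c)) ^ t) ∧
        ∀ x ∈ cell c q' p', ∀ j : ℕ, q ≤ j → j < q' → ∀ v : Fin m → ℤ,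
          ∃ i, 1 / 4 * (j : ℝ) ^ (-1 - c) ≤ |x i - v i / j| := by
  classical
  have hm1 : (1 : ℝ) ≤ m := by exact_mod_cast Nat.one_le_iff_ne_zero.2 hm
  have hm0 : (0 : ℝ) < m := by linarith
  have hmc : 1 < m * c := by nlinarith
  have hc0 : 0 < c := by
    by_contra! h
    nlinarith
  have hsm : s < m := by nlinarith
  obtain ⟨E, hE⟩ : ∃ E : ℝ, E = 1 / (8 * 2 ^ m) := ⟨_, rfl⟩
  have hE0 : 0 < E := by rw [hE]; positivity
  set Z : ℝ := ∑' a : ℕ, (a : ℝ) ^ (-(m * c)) with hZ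
  have e1 := eventually_mul_rpow_lt (α := 1 + m * η - m * c) (β := 0) (C := 3 ^ m * 8 ^ m * Z)
    (D := E * (1 / 4) ^ m) (by linarith) (by positivity)
  have e2 := eventually_mul_rpow_lt (α := (-1 - c) * (t - s)) (β := 0)
    (C := 10 ^ m * (1 / 4) ^ (t - s)) (D := E / 4) (by nlinarith) (by positivity)
  obtain ⟨q₀, hq₀⟩ := eventually_atTop.1 (e1.and e2)
  refine ⟨q₀, fun q p hqq hp U d hd hU hΦ => ?_⟩
  obtain ⟨h1, h2⟩ := hq₀ q hqq
  have hq1 : (1 : ℝ) < q := by exact_mod_cast hp.1.one_lt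
  have hq0 : (0 : ℝ) < q := by linarith
  set ε : ℝ := (q : ℝ) ^ (-1 - c) with hε
  have hε0 : 0 < ε := by positivity
  have hε1 : ε < 1 := Real.rpow_lt_one_of_one_lt_of_neg hq1 (by linarith)
  set ρ : ℝ := 1 / 4 * ε with hρ
  have hρ0 : 0 < ρ := by positivity
  have hρ1 : ρ < 1 := by linarith
  obtain ⟨R, hqR, hR⟩ := exists_tail_le hmc (ε := E * ρ ^ m) (by positivity) q
  have hR1 : 1 ≤ R := hp.1.one_lt.le.trans hqR
  have hR0 : (0 : ℝ) < R := by exact_mod_cast hR1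
  have hDsum : 3 ^ m * ∑ d ∈ nearby c q p R, (1 / 2 * (d.1 : ℝ) ^ (-1 - c)) ^ m ≤ E * ρ ^ m := by
    calc _ ≤ 3 ^ m * (8 ^ m * Z * ((q : ℝ) ^ (1 + m * η - m * c) * ε ^ m)) := by
          gcongr
          exact sum_nearby_le hm hη hmc hp R
      _ = 3 ^ m * 8 ^ m * Z * (q : ℝ) ^ (1 + m * η - m * c) * ε ^ m := by ring
      _ ≤ E * (1 / 4) ^ m * (q : ℝ) ^ (0 : ℝ) * ε ^ m := by gcongr
      _ = E * ρ ^ m := by rw [Real.rpow_zero, hρ, mul_pow]; ring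
  obtain ⟨Q₀, hQ₀⟩ := exists_many_good hm (c := c) hη hρ0 hρ1 R hR1 hE hR (nearby c q p R)
    (fun d i => (d.2 i : ℝ) / d.1) (fun d => 1 / 2 * (d.1 : ℝ) ^ (-1 - c))
    (by
      rintro ⟨j, v⟩ hd
      simp only [nearby, Finset.mem_sigma, Finset.mem_Ico] at hd
      have : (0 : ℝ) < j := by exact_mod_cast hp.1.pos.trans_le hd.1.1
      positivity) hDsum (fun i => p i / q + 1 / 2 * ε)
  have e3 := eventually_count hm (E := E / 4) hρ0 (by positivity) hc hηs ht
  have e4 := eventually_mul_rpow_lt (α := -1 - c) (β := 0) (C := 1) (D := 1 / 8 * ε)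
    (by linarith) (by positivity)
  have e5 := eventually_mul_rpow_lt (α := -1 - c) (β := 0) (C := 3) (D := (R : ℝ) ^ (-1 - c))
    (by linarith) (by positivity)
  obtain ⟨Q₁, hQ₁⟩ := eventually_atTop.1 (e3.and (e4.and e5))
  obtain ⟨Q, hQm, hQ1, hQp⟩ := exists_many_primes hη hη1 (max (max Q₀ q) Q₁)
  obtain ⟨⟨c1, c2, c3⟩, c4, c5⟩ := hQ₁ Q ((le_max_right _ _).trans hQm)
  have hQQ₀ : Q₀ ≤ Q := ((le_max_left _ _).trans (le_max_left _ _)).trans hQm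
  have hqQ : q ≤ Q := ((le_max_right _ _).trans (le_max_left _ _)).trans hQm
  have hQ0 : (0 : ℝ) < Q := by exact_mod_cast hQ1
  choose! S hS hScard using hQ₀
  set P := (Finset.Ioc Q (2 * Q)).filter Nat.Prime with hP
  have hPm : ∀ q' ∈ P, Q < q' ∧ q' ≤ 2 * Q ∧ q'.Prime ∧ Q₀ ≤ q' := by
    intro q' hq'
    obtain ⟨a1, a2⟩ := Finset.mem_filter.1 hq'
    obtain ⟨a3, a4⟩ := Finset.mem_Ioc.1 a1
    exact ⟨a3, a4, a2, by omega⟩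
  set F : Finset (Σ _ : ℕ, Fin m → ℤ) := P.sigma S with hF
  have hFm : ∀ k ∈ F, k.1 ∈ P ∧ k.2 ∈ S k.1 := fun k hk => Finset.mem_sigma.1 hk
  have hlevel : ∀ k ∈ F, (k.1 : ℝ) ^ (-1 - c) ≤ (Q : ℝ) ^ (-1 - c) := by
    intro k hk
    refine Real.rpow_le_rpow_of_nonpos hQ0 ?_ (by linarith)
    exact_mod_cast (hPm _ (hFm k hk).1).1.le
  rw [Real.rpow_zero, mul_one] at h1 h2 c4 c5
  rw [one_mul] at c4
  have hsub : ∀ k ∈ F, cell c k.1 k.2 ⊆ cell c q p := by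
    intro k hk
    obtain ⟨a1, a2⟩ := hFm k hk
    obtain ⟨b1, b2, b3, b4⟩ := hPm _ a1
    have hk0 : (0 : ℝ) < k.1 := by exact_mod_cast b3.pos
    refine cell_subset_cell (fun i => ?_) ((hlevel k hk).trans c4.le)
    have h3 := (hS k.1 b4 b3 k.2 a2).1 i
    have h4 : |(k.2 i : ℝ) - k.1 * (p i / q + 1 / 2 * ε)| =
        k.1 * |(k.2 i : ℝ) / k.1 - (p i / q + 1 / 2 * ε)| := by
      rw [← abs_of_pos hk0, ← abs_mul, abs_of_pos hk0]; congr 1; field_simp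
    rw [h4, mul_div_assoc] at h3
    have h5 := le_of_mul_le_mul_left h3 hk0
    refine h5.trans (le_of_eq ?_)
    rw [hρ]; ring
  set h : ℝ := (P.card : ℝ) with hh
  have hh0 : 0 ≤ h := Nat.cast_nonneg _
  have hFcard : h * (E * (ρ ^ m * (Q : ℝ) ^ m)) ≤ F.card := by
    rw [hF, Finset.card_sigma, Nat.cast_sum, hh, ← nsmul_eq_mul]
    refine Finset.card_nsmul_le_sum _ _ _ fun q' hq' => ?_
    obtain ⟨b1, b2, b3, b4⟩ := hPm _ hq'
    refine le_trans ?_ (hScard q' b4 b3)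
    have : (Q : ℝ) ≤ q' := by exact_mod_cast b1.le
    gcongr
  set θ : ℝ := (1 / 4 * ((2 * Q : ℕ) : ℝ) ^ (-1 - c)) ^ t with hθ
  have hθ0 : 0 < θ := by
    have : (0 : ℝ) < ((2 * Q : ℕ) : ℝ) := by positivity
    positivity
  have hsmall : ∀ i, (U i ∩ cell c q p).Nonempty → d i ≤ ρ := by
    intro i hi
    have h3 := (le_hitMass U (fun i => ENNReal.ofReal (d i ^ s)) _ hi).trans_lt hΦ
    rw [ENNReal.ofReal_lt_ofReal_iff (by positivity)] at h3
    by_contra! hlt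
    have h4 : ρ ^ s ≤ d i ^ s := Real.rpow_le_rpow hρ0.le hlt.le hs.le
    have h5 : ρ ^ t ≤ ρ ^ s := Real.rpow_le_rpow_of_exponent_ge hρ0 hρ1.le hst.le
    linarith
  set A : ℝ := h * (10 * Q) ^ m * ρ ^ ((m : ℝ) - s) with hA
  set B : ℝ := (8 / ((2 * Q : ℕ) : ℝ) ^ (-1 - 1 / (m : ℝ) - η)) ^ m * (Q : ℝ) ^ (-((m : ℝ) - s))
    with hB
  have hN0 : 0 < ρ ^ m * (Q : ℝ) ^ m := by positivity
  have hAt : A * ρ ^ t ≤ h * (E / 4 * (ρ ^ m * (Q : ℝ) ^ m)) :=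
    mul_rpow_le_of_le hh0 hρ0 hQ0.le (by
      rw [hρ, Real.mul_rpow (by norm_num) hε0.le, hε, ← Real.rpow_mul hq0.le, ← mul_assoc]
      exact h2.le)
  have hprimes : E / 4 * (Q : ℝ) ^ (1 - η) * (ρ ^ m * (Q : ℝ) ^ m) ≤
      h * (E / 4 * (ρ ^ m * (Q : ℝ) ^ m)) := by
    rw [mul_comm (E / 4), mul_assoc]
    gcongr
  have hmain : (θ * (A + B) + 1) * ρ ^ t < F.card * θ :=
    add_mul_lt_of_le hθ0 hAt (c2.le.trans hprimes)
      (c3.trans_le (mul_le_mul_of_nonneg_right hprimes hθ0.le)) hFcard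
      (by positivity)
  have hK0 : 0 ≤ θ * (A + B) + 1 := by positivity
  obtain ⟨k, hk, hkΦ⟩ := exists_hitMass_lt F (fun k => cell c k.1 k.2) (cell c q p) hsub U
    (fun i => ENNReal.ofReal (d i ^ s)) (ENNReal.ofReal θ) (ENNReal.ofReal (θ * (A + B) + 1))
    (by
      intro i hi
      have h3 := card_hit_mul_min_le hm hη hc0 hsm hθ0 hQ1 c1 F (fun k hk =>
        ⟨(Finset.mem_filter.1 (hFm k hk).1).1, (hS k.1 (hPm _ (hFm k hk).1).2.2.2
          (hPm _ (hFm k hk).1).2.2.1 k.2 (hFm k hk).2).2.1⟩) (U i) (hd i) (hsmall i hi) (hU i)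
      rw [← ENNReal.ofReal_min, ← ENNReal.ofReal_natCast, ← ENNReal.ofReal_mul (by positivity),
        ← ENNReal.ofReal_mul hK0]
      exact ENNReal.ofReal_le_ofReal h3)
    (by
      calc _ ≤ ENNReal.ofReal (θ * (A + B) + 1) * ENNReal.ofReal (ρ ^ t) := by gcongr
        _ = ENNReal.ofReal ((θ * (A + B) + 1) * ρ ^ t) := (ENNReal.ofReal_mul hK0).symm
        _ < ENNReal.ofReal (F.card * θ) := by
            refine (ENNReal.ofReal_lt_ofReal_iff ?_).2 hmain
            refine lt_of_le_of_lt ?_ hmain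
            positivity
        _ = F.card * ENNReal.ofReal θ := by
            rw [ENNReal.ofReal_mul (by positivity), ENNReal.ofReal_natCast])
  obtain ⟨a1, a2⟩ := hFm k hk
  obtain ⟨b1, b2, b3, b4⟩ := hPm _ a1
  obtain ⟨-, g1, g2, g3⟩ := hS k.1 b4 b3 k.2 a2
  have hk0 : (0 : ℝ) < k.1 := by exact_mod_cast b3.pos
  refine ⟨k.1, k.2, hqQ.trans_lt b1, g1, hsub k hk, hkΦ.trans_le ?_, fun x hx j hj hj' v => ?_⟩
  · refine ENNReal.ofReal_le_ofReal (Real.rpow_le_rpow (by positivity) ?_ (by linarith))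
    gcongr 1 / 4 * ?_
    exact Real.rpow_le_rpow_of_nonpos hk0 (by exact_mod_cast b2) (by linarith)
  · exact exists_le_abs_sub_of_mem_cell hm hc0 hp.1.pos b3.pos (hsub k hk hx) hx
      ((mul_le_mul_of_nonneg_left (hlevel k hk) (by norm_num)).trans c5.le) g2 g3 hj hj' v

lemma cell_eq_Icc {m : ℕ} (c : ℝ) (q : ℕ) (p : Fin m → ℤ) :
    cell c q p = Set.Icc (fun i => (p i : ℝ) / q + 1 / 4 * (q : ℝ) ^ (-1 - c))
      (fun i => (p i : ℝ) / q + 3 / 4 * (q : ℝ) ^ (-1 - c)) := by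
  ext x
  simp only [cell, mem_ofPred_eq, Set.mem_Icc, Pi.le_def]
  rw [← forall_and]
  exact forall_congr' fun i => and_congr le_sub_iff_add_le' sub_le_iff_le_add'

lemma isCompact_cell {m : ℕ} (c : ℝ) (q : ℕ) (p : Fin m → ℤ) : IsCompact (cell c q p) := by
  rw [cell_eq_Icc]; exact isCompact_Icc

lemma cell_nonempty {m : ℕ} (c : ℝ) (q : ℕ) (p : Fin m → ℤ) : (cell c q p).Nonempty := by
  rw [cell_eq_Icc, Set.nonempty_Icc]
  intro i
  have : (0 : ℝ) ≤ (q : ℝ) ^ (-1 - c) := by positivity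
  dsimp only
  linarith

open Filter Topology in
/-- Every ball contains a good cell of arbitrarily large level. -/
lemma exists_cell_subset {m : ℕ} (hm : m ≠ 0) {c η : ℝ} (hη : 0 < η) (hc : 1 < m * c)
    (x : Fin m → ℝ) {r : ℝ} (hr : 0 < r) (q₀ : ℕ) :
    ∃ (q : ℕ) (p : Fin m → ℤ), q₀ ≤ q ∧ IsGood η q p ∧ cell c q p ⊆ Metric.closedBall x r := by
  have hm0 : (0 : ℝ) < m := by exact_mod_cast Nat.pos_of_ne_zero hm
  have hc0 : 0 < c := by
    by_contra! h
    nlinarith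
  obtain ⟨E, hE⟩ : ∃ E : ℝ, E = 1 / (8 * 2 ^ m) := ⟨_, rfl⟩
  have hE0 : 0 < E := by rw [hE]; positivity
  set ρ : ℝ := min r (1 / 2) with hρ
  have hρ0 : 0 < ρ := lt_min hr (by norm_num)
  have hρ1 : ρ < 1 := (min_le_right _ _).trans_lt (by norm_num)
  obtain ⟨R, hR1, hR⟩ := exists_tail_le hc (ε := E * ρ ^ m) (by positivity) 1
  obtain ⟨Q₀, hQ₀⟩ := exists_many_good hm (c := c) hη hρ0 hρ1 R hR1 hE hR (∅ : Finset ℕ)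
    (fun _ _ => 0) (fun _ => 1) (by simp) (by simp; positivity) x
  obtain ⟨Q₁, hQ₁⟩ := eventually_atTop.1 (eventually_mul_rpow_lt (α := -1 - c) (β := 0) (C := 1)
    (D := r / 2) (by linarith) (by positivity))
  obtain ⟨q, hq, hqp⟩ := Nat.exists_infinite_primes (max (max q₀ Q₀) Q₁)
  obtain ⟨S, hS, hScard⟩ := hQ₀ q (((le_max_right _ _).trans (le_max_left _ _)).trans hq) hqp
  have hq0 : (0 : ℝ) < q := by exact_mod_cast hqp.pos
  have hSpos : (0 : ℝ) < S.card := lt_of_lt_of_le (by positivity) hScard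
  obtain ⟨p, hp⟩ := Finset.card_pos.1 (by exact_mod_cast hSpos)
  obtain ⟨h1, h2, -⟩ := hS p hp
  refine ⟨q, p, ((le_max_left _ _).trans (le_max_left _ _)).trans hq, h2, fun y hy => ?_⟩
  rw [Metric.mem_closedBall, dist_pi_le_iff hr.le]
  intro i
  have h3 := hQ₁ q ((le_max_right _ _).trans hq)
  rw [Real.rpow_zero, mul_one, one_mul] at h3
  have h4 := abs_sub_le_of_mem_cell hy i
  have h5 : |(p i : ℝ) - q * x i| = q * |(p i : ℝ) / q - x i| := by
    rw [← abs_of_pos hq0, ← abs_mul, abs_of_pos hq0]; congr 1; field_simp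
  have h6 := h1 i
  rw [h5, mul_div_assoc] at h6
  have h7 := le_of_mul_le_mul_left h6 hq0
  have h8 : ρ ≤ r := min_le_left _ _
  have h9 := abs_sub_le (y i) ((p i : ℝ) / q) (x i)
  rw [Real.dist_eq]
  have : 0 ≤ (q : ℝ) ^ (-1 - c) := by positivity
  linarith

open Filter Topology in
/-- A good cell of small hitting mass contains a badly approximable point outside all the sets
`U i`. -/
lemma exists_mem_cell_notMem {m : ℕ} (hm : m ≠ 0) {c η s t : ℝ} (hη : 0 < η) (hη1 : η < 1)
    (hs : 0 < s) (hst : s < t) (hc : m * η < m * c - 1) (hηs : (m + 1) * η < m - s)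
    (ht : (1 + c) * t < m + 1 - η) :
    ∃ q₀ : ℕ, ∀ (q : ℕ) (p : Fin m → ℤ), q₀ ≤ q → IsGood η q p →
      ∀ (U : ℕ → Set (Fin m → ℝ)) (d : ℕ → ℝ), (∀ i, 0 < d i) →
      (∀ i, ∀ x ∈ U i, ∀ y ∈ U i, ∀ k, |x k - y k| ≤ d i) →
      hitMass U (fun i => ENNReal.ofReal (d i ^ s)) (cell c q p) <
        ENNReal.ofReal ((1 / 4 * (q : ℝ) ^ (-1 - c)) ^ t) →
      ∃ x ∈ cell c q p, (∀ i, x ∉ U i) ∧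
        {n : ℕ | 0 < n ∧ ∃ v : Fin m → ℤ, x ∈ cell c n v}.Infinite ∧
        ∀ j : ℕ, q ≤ j → ∀ v : Fin m → ℤ, ∃ i, 1 / 4 * (j : ℝ) ^ (-1 - c) ≤ |x i - v i / j| := by
  have hc0 : 0 < c := by
    have hm0 : (0 : ℝ) < m := by exact_mod_cast Nat.pos_of_ne_zero hm
    by_contra! h
    nlinarith
  obtain ⟨q₀, hstep⟩ := exists_next_cell hm hη hη1 hs hst hc hηs ht
  refine ⟨q₀, fun q p hq hp U d hd hU hΦ => ?_⟩
  let T := {k : Σ _ : ℕ, Fin m → ℤ // q₀ ≤ k.1 ∧ IsGood η k.1 k.2 ∧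
    hitMass U (fun i => ENNReal.ofReal (d i ^ s)) (cell c k.1 k.2) <
      ENNReal.ofReal ((1 / 4 * (k.1 : ℝ) ^ (-1 - c)) ^ t)}
  have hnext : ∀ k : T, ∃ l : T, k.1.1 < l.1.1 ∧ cell c l.1.1 l.1.2 ⊆ cell c k.1.1 k.1.2 ∧
      ∀ x ∈ cell c l.1.1 l.1.2, ∀ j : ℕ, k.1.1 ≤ j → j < l.1.1 → ∀ v : Fin m → ℤ,
        ∃ i, 1 / 4 * (j : ℝ) ^ (-1 - c) ≤ |x i - v i / j| := by
    rintro ⟨⟨a, u⟩, h1, h2, h3⟩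
    obtain ⟨b, v, g1, g2, g3, g4, g5⟩ := hstep a u h1 h2 U d hd hU h3
    exact ⟨⟨⟨b, v⟩, h1.trans g1.le, g2, g4⟩, g1, g3, g5⟩
  choose next hlt hsub hbad using hnext
  let k : ℕ → T := fun n => next^[n] ⟨⟨q, p⟩, hq, hp, hΦ⟩
  have hk : ∀ n, k (n + 1) = next (k n) := fun n => Function.iterate_succ_apply' _ _ _
  have hmono : StrictMono fun n => (k n).1.1 := strictMono_nat_of_lt_succ fun n => by
    rw [hk]; exact hlt _
  obtain ⟨x, hx⟩ := IsCompact.nonempty_iInter_of_sequence_nonempty_isCompact_isClosed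
    (fun n => cell c (k n).1.1 (k n).1.2) (fun n => by rw [hk]; exact hsub _)
    (fun n => cell_nonempty _ _ _) (isCompact_cell _ _ _) (fun n => (isCompact_cell _ _ _).isClosed)
  rw [mem_iInter] at hx
  refine ⟨x, hx 0, fun i hi => ?_, ?_, fun j hj v => ?_⟩
  · have h1 : ∀ n, d i ^ s < (1 / 4 * ((k n).1.1 : ℝ) ^ (-1 - c)) ^ t := by
      intro n
      have h2 := (le_hitMass U (fun i => ENNReal.ofReal (d i ^ s)) _ (i := i)
        ⟨x, hi, hx n⟩).trans_lt (k n).2.2.2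
      exact (ENNReal.ofReal_lt_ofReal_iff_of_nonneg (Real.rpow_nonneg (hd i).le _)).1 h2
    have h3 : Tendsto (fun n => (1 / 4 * ((k n).1.1 : ℝ) ^ (-1 - c)) ^ t) atTop
        (𝓝 ((1 / 4 * 0) ^ t)) := by
      have h4 : Tendsto (fun n => ((k n).1.1 : ℝ) ^ (-(1 + c))) atTop (𝓝 0) :=
        (tendsto_rpow_neg_atTop (by linarith)).comp
          (tendsto_natCast_atTop_atTop.comp hmono.tendsto_atTop)
      rw [show -(1 + c) = -1 - c by ring] at h4
      exact (h4.const_mul _).rpow_const (Or.inr (by linarith))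
    rw [mul_zero, Real.zero_rpow (by linarith)] at h3
    have h5 := ge_of_tendsto' h3 fun n => (h1 n).le
    have h6 := Real.rpow_pos_of_pos (hd i) s
    linarith
  · refine Set.infinite_of_injective_forall_mem hmono.injective fun n => ?_
    exact ⟨(k n).2.2.1.1.pos, _, hx n⟩
  · obtain ⟨n, hn⟩ : ∃ n, j < (k n).1.1 := ⟨j + 1, lt_of_lt_of_le (Nat.lt_succ_self j)
      (hmono.le_apply)⟩
    have hex : ∃ n, j < (k n).1.1 := ⟨n, hn⟩
    classical
    obtain ⟨l, hl⟩ : ∃ l, Nat.find hex = l + 1 := by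
      refine Nat.exists_eq_succ_of_ne_zero fun h0 => ?_
      have h1 := Nat.find_spec hex
      rw [h0] at h1
      exact absurd hj (not_le.2 h1)
    have h1 := Nat.find_spec hex
    rw [hl] at h1
    have h2 : (k l).1.1 ≤ j := not_lt.1 (Nat.find_min hex (by omega))
    have h3 := hx (l + 1)
    rw [hk] at h1 h3
    exact hbad (k l) x h3 j h2 h1 v

lemma mul_rpow_neg_one_sub {n : ℕ} (hn : 0 < n) (c : ℝ) :
    (n : ℝ) * (n : ℝ) ^ (-1 - c) = (n : ℝ) ^ (-c) := by
  have hn' : (0 : ℝ) < n := by exact_mod_cast hn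
  rw [show -c = 1 + (-1 - c) by ring, Real.rpow_add hn', Real.rpow_one]

lemma abs_mul_sub_eq {n : ℕ} (hn : 0 < n) (x v : ℝ) : |(n : ℝ) * x - v| = n * |x - v / n| := by
  have hn' : (0 : ℝ) < n := by exact_mod_cast hn
  rw [← abs_of_pos hn', ← abs_mul, abs_of_pos hn']
  congr 1
  field_simp

lemma mem_badSet {m : ℕ} {c : ℝ} {τ : Fin m → ℝ} (hτ : ∀ i, τ i = c) {x : Fin m → ℝ}
    (hx : ∀ i, x i ∈ Icc (0 : ℝ) 1)
    (hinf : {n : ℕ | 0 < n ∧ ∃ v : Fin m → ℤ, x ∈ cell c n v}.Infinite) {q : ℕ}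
    (hav : ∀ j : ℕ, q ≤ j → ∀ v : Fin m → ℤ, ∃ i, 1 / 4 * (j : ℝ) ^ (-1 - c) ≤ |x i - v i / j|) :
    x ∈ badSet m (psiTau m τ) := by
  refine ⟨⟨hx, hinf.mono ?_⟩, ?_⟩
  · rintro n ⟨hn, v, hv⟩
    refine ⟨hn, v, fun i => ?_⟩
    have hn' : (0 : ℝ) < n := by exact_mod_cast hn
    have h := abs_sub_le_of_mem_cell hv i
    have hp : (0 : ℝ) < (n : ℝ) ^ (-c) := Real.rpow_pos_of_pos hn' _
    rw [abs_mul_sub_eq hn, psiTau, hτ]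
    calc (n : ℝ) * |x i - v i / n| ≤ n * (3 / 4 * (n : ℝ) ^ (-1 - c)) := by gcongr
      _ = 3 / 4 * (n : ℝ) ^ (-c) := by rw [← mul_rpow_neg_one_sub hn c]; ring
      _ < _ := by linarith
  · intro h
    have h4 := (mem_iInter₂.1 h (1 / 4) ⟨by norm_num, by norm_num⟩).2
    refine h4 ((finite_lt_nat q).subset ?_)
    rintro n ⟨hn, v, hv⟩
    by_contra hqn
    obtain ⟨i, hi⟩ := hav n (not_lt.1 hqn) v
    have hn' : (0 : ℝ) < n := by exact_mod_cast hn
    have h1 : |(n : ℝ) * x i - v i| < 1 / 4 * (n : ℝ) ^ (-(τ i)) := hv i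
    rw [abs_mul_sub_eq hn, hτ, ← mul_rpow_neg_one_sub hn c] at h1
    have h2 := mul_le_mul_of_nonneg_left hi hn'.le
    linarith

lemma exists_cover_of_hausdorffMeasure_eq_zero {m : ℕ} {A : Set (Fin m → ℝ)} {s : ℝ} (hs : 0 < s)
    (hA : μH[s] A = 0) {a : ℝ} (ha : 0 < a) :
    ∃ (U : ℕ → Set (Fin m → ℝ)) (d : ℕ → ℝ), A ⊆ ⋃ i, U i ∧ (∀ i, 0 < d i) ∧
      (∀ i, ∀ x ∈ U i, ∀ y ∈ U i, ∀ k, |x k - y k| ≤ d i) ∧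
      ∑' i, ENNReal.ofReal (d i ^ s) < ENNReal.ofReal a := by
  have ha2 : (0 : ENNReal) < ENNReal.ofReal (a / 2) := by simpa using ha
  rw [Measure.hausdorffMeasure_apply] at hA
  have h1 := (le_iSup₂ (f := fun (r : ENNReal) (_ : 0 < r) =>
        ⨅ (t : ℕ → Set (Fin m → ℝ)) (_ : A ⊆ ⋃ n, t n) (_ : ∀ n, Metric.ediam (t n) ≤ r),
          ∑' n, ⨆ _ : (t n).Nonempty, Metric.ediam (t n) ^ s) 1 one_pos).trans_eq hA
  have h2 := lt_of_le_of_lt h1 ha2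
  simp only [iInf_lt_iff] at h2
  obtain ⟨U, hU, hd, hsum⟩ := h2
  obtain ⟨ε, hε, hεs⟩ := ENNReal.exists_pos_sum_of_countable ha2.ne' ℕ
  have hfin : ∀ i, Metric.ediam (U i) ≠ ⊤ := fun i =>
    ne_top_of_le_ne_top ENNReal.one_ne_top (hd i)
  have hpos : ∀ i, 0 < (Metric.ediam (U i)).toReal ^ s + ε i := fun i => by
    have := hε i
    have : (0 : ℝ) < ε i := by exact_mod_cast this
    positivity
  refine ⟨U, fun i => ((Metric.ediam (U i)).toReal ^ s + ε i) ^ (1 / s), hU,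
    fun i => Real.rpow_pos_of_pos (hpos i) _, fun i x hx y hy k => ?_, ?_⟩
  · have e1 : |x k - y k| ≤ (Metric.ediam (U i)).toReal := by
      rw [← Real.dist_eq]
      refine (dist_le_pi_dist x y k).trans ?_
      rw [dist_edist]
      exact ENNReal.toReal_mono (hfin i) (Metric.edist_le_ediam_of_mem hx hy)
    refine e1.trans ?_
    have e2 : (Metric.ediam (U i)).toReal = ((Metric.ediam (U i)).toReal ^ s) ^ (1 / s) := by
      rw [← Real.rpow_mul ENNReal.toReal_nonneg, mul_one_div_cancel hs.ne', Real.rpow_one]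
    calc _ = ((Metric.ediam (U i)).toReal ^ s) ^ (1 / s) := e2
      _ ≤ _ := Real.rpow_le_rpow (by positivity) (by simp) (by positivity)
  · have e : ∀ i, ENNReal.ofReal ((((Metric.ediam (U i)).toReal ^ s + ε i) ^ (1 / s)) ^ s) =
        (⨆ _ : (U i).Nonempty, Metric.ediam (U i) ^ s) + ε i := fun i => by
      rw [← Real.rpow_mul (hpos i).le, one_div_mul_cancel hs.ne', Real.rpow_one,
        ENNReal.ofReal_add (by positivity) (by positivity), ENNReal.ofReal_coe_nnreal,
        ← ENNReal.ofReal_rpow_of_nonneg ENNReal.toReal_nonneg hs.le,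
        ENNReal.ofReal_toReal (hfin i)]
      congr 1
      rcases (U i).eq_empty_or_nonempty with h | h
      · simp [h, hs]
      · simp [h]
    simp only [e]
    rw [ENNReal.tsum_add]
    calc _ < ENNReal.ofReal (a / 2) + ENNReal.ofReal (a / 2) := ENNReal.add_lt_add hsum hεs
      _ = ENNReal.ofReal a := by rw [← ENNReal.ofReal_add (by positivity) (by positivity)]; simp

lemma hausdorffMeasure_badSet_ne_zero {m : ℕ} (hm : m ≠ 0) {c : ℝ} (hc : 1 < m * c)
    {τ : Fin m → ℝ} (hτ : ∀ i, τ i = c) {x : Fin m → ℝ} {r : ℝ} (hr : 0 < r)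
    (hB : Metric.closedBall x r ⊆ {y : Fin m → ℝ | ∀ i, y i ∈ Icc (0 : ℝ) 1})
    {s : ℝ} (hs : 0 < s) (hs' : s < (m + 1) / (1 + c)) :
    μH[s] (Metric.closedBall x r ∩ badSet m (psiTau m τ)) ≠ 0 := by
  intro h0
  have hm' : (0 : ℝ) < m := by exact_mod_cast Nat.pos_of_ne_zero hm
  have hc0 : 0 < c := by
    by_contra h
    nlinarith
  have hs1 : (1 + c) * s < m + 1 := by
    rw [lt_div_iff₀ (by linarith)] at hs'; linarith
  have hsm : s < m := by
    by_contra h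
    nlinarith
  set t := (s + (m + 1) / (1 + c)) / 2 with ht
  have hst : s < t := by linarith
  have ht1 : (1 + c) * t < m + 1 := by
    have : t < (m + 1) / (1 + c) := by linarith
    rw [lt_div_iff₀ (by linarith)] at this; linarith
  obtain ⟨η, hη, hlt⟩ : ∃ η : ℝ, 0 < η ∧ η < min (min 1 ((m * c - 1) / m))
      (min ((m - s) / (m + 1)) (m + 1 - (1 + c) * t)) := by
    refine exists_between (lt_min (lt_min one_pos (div_pos ?_ hm')) (lt_min (div_pos ?_ ?_) ?_)) <;>
      linarith
  simp only [lt_min_iff] at hlt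
  obtain ⟨⟨hη1, hη2⟩, hη3, hη4⟩ := hlt
  rw [lt_div_iff₀ hm'] at hη2
  rw [lt_div_iff₀ (by linarith)] at hη3
  obtain ⟨q₀, hq₀⟩ := exists_mem_cell_notMem hm hη hη1 hs hst (c := c) (by linarith)
    (by linarith) (by linarith)
  obtain ⟨q, p, hq, hg, hsub⟩ := exists_cell_subset hm hη hc x hr q₀
  have hqp : (0 : ℝ) < q := by exact_mod_cast hg.1.pos
  obtain ⟨U, d, hU, hd, hdiam, hsum⟩ := exists_cover_of_hausdorffMeasure_eq_zero hs h0
    (a := (1 / 4 * (q : ℝ) ^ (-1 - c)) ^ t) (by positivity)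
  obtain ⟨y, hy, hyU, hinf, hav⟩ := hq₀ q p hq hg U d hd hdiam
    ((hitMass_mono U _ _).trans_lt hsum)
  obtain ⟨i, hi⟩ := mem_iUnion.1 (hU ⟨hsub hy, mem_badSet hτ (hB (hsub hy)) hinf hav⟩)
  exact hyU i hi

lemma le_dimH_badSet {m : ℕ} (hm : m ≠ 0) {c : ℝ} (hc : 1 < m * c)
    {τ : Fin m → ℝ} (hτ : ∀ i, τ i = c) {x : Fin m → ℝ} {r : ℝ} (hr : 0 < r)
    (hB : Metric.closedBall x r ⊆ {y : Fin m → ℝ | ∀ i, y i ∈ Icc (0 : ℝ) 1}) :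
    ENNReal.ofReal ((m + 1) / (1 + c)) ≤
      dimH (Metric.closedBall x r ∩ badSet m (psiTau m τ)) := by
  refine le_of_forall_lt fun a ha => ?_
  obtain ⟨b, hab, hb⟩ := ENNReal.lt_iff_exists_nnreal_btwn.1 ha
  have hb0 : 0 < b := ENNReal.coe_pos.1 (lt_of_le_of_lt zero_le hab)
  refine hab.trans_le ?_
  by_contra h
  refine hausdorffMeasure_badSet_ne_zero hm hc hτ hr hB (s := b) (by exact_mod_cast hb0) ?_
    (hausdorffMeasure_of_dimH_lt (not_le.1 h))
  rw [← ENNReal.ofReal_coe_nnreal] at hb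
  exact (ENNReal.ofReal_lt_ofReal_iff_of_nonneg b.coe_nonneg).1 hb

lemma exists_center_of_mem_approxSet {m : ℕ} {c : ℝ} {τ : Fin m → ℝ} (hτ : ∀ i, τ i = c)
    {x : Fin m → ℝ} (hx : x ∈ approxSet m (psiTau m τ)) (hc : 0 ≤ c) (n : ℕ) :
    ∃ q : ℕ, n < q ∧ ∃ p ∈ intBox (fun _ : Fin m => (0 : ℝ)) (q + 1),
      x ∈ Metric.closedBall (fun i => (p i : ℝ) / q) ((q : ℝ) ^ (-1 - c)) := by
  obtain ⟨h01, hinf⟩ := hx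
  obtain ⟨q, ⟨hq, p, hp⟩, hnq⟩ := hinf.exists_gt n
  have hq' : (0 : ℝ) < q := by exact_mod_cast hq
  refine ⟨q, hnq, p, mem_intBox.2 fun i => ?_, ?_⟩
  · have h1 := hp i
    rw [psiTau, hτ] at h1
    have h2 : (q : ℝ) ^ (-c) ≤ 1 :=
      Real.rpow_le_one_of_one_le_of_nonpos (by exact_mod_cast hq) (by linarith)
    have h3 := h01 i
    rw [abs_lt] at h1
    rw [abs_le]
    constructor <;> nlinarith [h3.1, h3.2]
  · rw [Metric.mem_closedBall, dist_pi_le_iff (by positivity)]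
    intro i
    have h1 := hp i
    rw [abs_mul_sub_eq hq, psiTau, hτ, ← mul_rpow_neg_one_sub hq c] at h1
    rw [Real.dist_eq]
    exact (lt_of_mul_lt_mul_left h1 hq'.le).le

lemma summable_card_intBox_mul {m : ℕ} {c s : ℝ} (hs : m + 1 < (1 + c) * s) :
    Summable fun q : ℕ => ((intBox (fun _ : Fin m => (0 : ℝ)) (q + 1)).card : ℝ) *
      (2 * (q : ℝ) ^ (-1 - c)) ^ s := by
  have h : Summable fun q : ℕ => (5 ^ m * 2 ^ s) * (q : ℝ) ^ (m - (1 + c) * s) :=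
    (Real.summable_nat_rpow.2 (by linarith)).mul_left _
  refine (summable_nat_add_iff 1).1 (Summable.of_nonneg_of_le (fun q => by positivity)
    (fun q => ?_) ((summable_nat_add_iff 1).2 h))
  have hq : (1 : ℝ) ≤ (q + 1 : ℕ) := by exact_mod_cast Nat.succ_pos q
  generalize ((q + 1 : ℕ) : ℝ) = y at hq
  have hy : 0 < y := by linarith
  calc _ ≤ (2 * (y + 1) + 1) ^ m * (2 * y ^ (-1 - c)) ^ s := by
        gcongr
        exact card_intBox_le _ (by linarith)
    _ ≤ (5 * y) ^ m * (2 * y ^ (-1 - c)) ^ s := by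
        gcongr
        linarith
    _ = _ := by
        rw [mul_pow, Real.mul_rpow (by norm_num) (by positivity), ← Real.rpow_mul hy.le,
          show (m : ℝ) - (1 + c) * s = m + (-1 - c) * s by ring, Real.rpow_add hy,
          Real.rpow_natCast]
        ring

lemma hausdorffMeasure_approxSet_ne_top {m : ℕ} {c s : ℝ} {τ : Fin m → ℝ} (hτ : ∀ i, τ i = c)
    (hc : 0 ≤ c) (hs : m + 1 < (1 + c) * s) (hs0 : 0 ≤ s) :
    μH[s] (approxSet m (psiTau m τ)) ≠ ⊤ := by
  set I : ℕ → Type := fun q => {p // p ∈ intBox (fun _ : Fin m => (0 : ℝ)) ((q : ℝ) + 1)}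
  set T : ∀ n : ℕ, (Σ q : {q : ℕ // n < q}, I q) → Set (Fin m → ℝ) := fun n z =>
    Metric.closedBall (fun i => (z.2.1 i : ℝ) / (z.1.1 : ℕ)) (((z.1.1 : ℕ) : ℝ) ^ (-1 - c))
  have hdiam : ∀ n z, Metric.ediam (T n z) ≤
      ENNReal.ofReal (2 * ((z.1.1 : ℕ) : ℝ) ^ (-1 - c)) := fun n z => by
    have h0 : (0 : ℝ) ≤ ((z.1.1 : ℕ) : ℝ) ^ (-1 - c) := by positivity
    refine (Metric.ediam_le_of_forall_dist_le (C := 2 * ((z.1.1 : ℕ) : ℝ) ^ (-1 - c)) ?_)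
    intro y hy y' hy'
    linarith [dist_triangle_right y y' (fun i => (z.2.1 i : ℝ) / (z.1.1 : ℕ)),
      Metric.mem_closedBall.1 hy, Metric.mem_closedBall.1 hy']
  have hsum := summable_card_intBox_mul hs
  have hbound : ∀ n : ℕ, ∑' z, Metric.ediam (T n z) ^ s ≤ ENNReal.ofReal (∑' q : ℕ,
      ((intBox (fun _ : Fin m => (0 : ℝ)) (q + 1)).card : ℝ) *
        (2 * (q : ℝ) ^ (-1 - c)) ^ s) := fun n => by
    rw [ENNReal.ofReal_tsum_of_nonneg (fun q => by positivity) hsum, ENNReal.tsum_sigma']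
    refine le_trans (ENNReal.tsum_le_tsum fun q => ?_)
      (ENNReal.tsum_comp_le_tsum_of_injective (f := fun q : {q : ℕ // n < q} => (q : ℕ))
        Subtype.val_injective (fun q : ℕ => ENNReal.ofReal
          (((intBox (fun _ : Fin m => (0 : ℝ)) (q + 1)).card : ℝ) *
            (2 * (q : ℝ) ^ (-1 - c)) ^ s)))
    calc _ ≤ ∑' _ : I q, ENNReal.ofReal ((2 * ((q : ℕ) : ℝ) ^ (-1 - c)) ^ s) := by
          refine ENNReal.tsum_le_tsum fun p => ?_
          rw [← ENNReal.ofReal_rpow_of_nonneg (by positivity) hs0]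
          exact ENNReal.rpow_le_rpow (hdiam n ⟨q, p⟩) hs0
      _ = _ := by
          rw [ENNReal.ofReal_mul (by positivity), ENNReal.ofReal_natCast, tsum_fintype,
            Finset.sum_const, nsmul_eq_mul]
          congr 2
          exact Fintype.card_coe _
  refine ne_top_of_le_ne_top (b := ENNReal.ofReal (∑' q : ℕ,
      ((intBox (fun _ : Fin m => (0 : ℝ)) (q + 1)).card : ℝ) *
        (2 * (q : ℝ) ^ (-1 - c)) ^ s)) ENNReal.ofReal_ne_top
    ((Measure.hausdorffMeasure_le_liminf_tsum s (approxSet m (psiTau m τ)) (l := Filter.atTop)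
      (fun n : ℕ => ENNReal.ofReal (2 * (n : ℝ) ^ (-1 - c))) ?_ T ?_ ?_).trans ?_)
  · have h := ((tendsto_rpow_neg_atTop (show 0 < 1 + c by linarith)).comp
      tendsto_natCast_atTop_atTop).const_mul 2
    rw [mul_zero] at h
    have h' := ENNReal.tendsto_ofReal h
    rw [ENNReal.ofReal_zero] at h'
    refine h'.congr fun n => ?_
    simp only [Function.comp_apply, neg_add']
  · filter_upwards [Filter.eventually_gt_atTop 0] with n hn z
    have hn' : (0 : ℝ) < n := by exact_mod_cast hn
    refine (hdiam n z).trans (ENNReal.ofReal_le_ofReal ?_)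
    have h : (n : ℝ) ≤ (z.1.1 : ℕ) := by exact_mod_cast z.1.2.le
    have := Real.rpow_le_rpow_of_nonpos hn' h (show -1 - c ≤ 0 by linarith)
    linarith
  · refine Filter.Eventually.of_forall fun n x hx => ?_
    obtain ⟨q, hq, p, hp, hxp⟩ := exists_center_of_mem_approxSet hτ hx hc n
    exact mem_iUnion.2 ⟨⟨⟨q, hq⟩, ⟨p, hp⟩⟩, hxp⟩
  · exact (Filter.liminf_le_liminf (Filter.Eventually.of_forall hbound)).trans_eq
      (Filter.liminf_const _)

lemma dimH_approxSet_le {m : ℕ} {c : ℝ} {τ : Fin m → ℝ} (hτ : ∀ i, τ i = c) (hc : 0 ≤ c) :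
    dimH (approxSet m (psiTau m τ)) ≤ ENNReal.ofReal ((m + 1) / (1 + c)) := by
  refine le_of_forall_gt fun a ha => ?_
  obtain ⟨b, hb, hab⟩ := ENNReal.lt_iff_exists_nnreal_btwn.1 ha
  refine lt_of_le_of_lt (dimH_le_of_hausdorffMeasure_ne_top
    (hausdorffMeasure_approxSet_ne_top hτ hc ?_ b.coe_nonneg)) hab
  rw [← ENNReal.ofReal_coe_nnreal, ENNReal.ofReal_lt_ofReal_iff_of_nonneg (by positivity),
    div_lt_iff₀ (by linarith)] at hb
  linarith

/-- Koivusalo–Levesley–Ward–Zhang: for constant weights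
`τ1 = ⋯ = τm = c > 1/m` and any ball `B ⊆ [0,1]^m` of positive radius,
`dim_H (B ∩ B_m(Ψ_τ)) = dim_H A_m(Ψ_τ) = (m+1)/(1+c)`. -/
theorem stmt14 (m : ℕ) (hm : 1 ≤ m) (c : ℝ) (hc : 1 / (m : ℝ) < c)
    (τ : Fin m → ℝ) (hτ : ∀ i, τ i = c)
    (x : Fin m → ℝ) (r : ℝ) (hr : 0 < r)
    (hB : Metric.closedBall x r ⊆ {y : Fin m → ℝ | ∀ i, y i ∈ Set.Icc (0:ℝ) 1}) :
    dimH (Metric.closedBall x r ∩ badSet m (psiTau m τ)) =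
      ENNReal.ofReal (((m : ℝ) + 1) / (1 + c)) ∧
    dimH (approxSet m (psiTau m τ)) = ENNReal.ofReal (((m : ℝ) + 1) / (1 + c)) := by
  have hm0 : m ≠ 0 := by omega
  have hm' : (0 : ℝ) < m := by exact_mod_cast hm
  have hc0 : 0 ≤ c := (lt_trans (by positivity) hc).le
  have hc1 : 1 < m * c := by
    rw [div_lt_iff₀ hm'] at hc
    linarith
  have hlow := le_dimH_badSet hm0 hc1 hτ hr hB
  have hup := dimH_approxSet_le hτ hc0
  have hsub : dimH (Metric.closedBall x r ∩ badSet m (psiTau m τ)) ≤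
      dimH (approxSet m (psiTau m τ)) := dimH_mono (inter_subset_right.trans sdiff_subset)
  exact ⟨le_antisymm (hsub.trans hup) hlow, le_antisymm hup (hlow.trans hsub)⟩
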